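/- arXiv:math/0406434 — 5 statements merged into one kernel-verified Lean document; each statement's English description precedes it below -/
import Mathlib

section
/- Let n be a positive integer and write n = 2^r · m with r ≥ 0 and m odd. Then the number of quadruples (x, y, z, w) ∈ ℤ⁴ with x² + y² + 2z² + 2w² = n equals 4σ(m) if r = 0, equals 8σ(m) if r = 1, and equals 24σ(m) if r ≥ 2. -/
open Finset

/-- The integer vectors indexed by `ι` whose squared entries sum to `n`. -/
noncomputable def squareReps (ι : Type) [Fintype ι] [DecidableEq ι] (n : ℤ) : Finset (ι → ℤ) :=
  {v ∈ Fintype.piFinset fun _ => Icc (-n) n | ∑ i, v i ^ 2 = n}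

/-- The vectors of odd integers indexed by `ι` whose squared entries sum to `n`. -/
noncomputable def oddSquareReps (ι : Type) [Fintype ι] [DecidableEq ι] (n : ℤ) : Finset (ι → ℤ) :=
  {v ∈ squareReps ι n | ∀ i, Odd (v i)}

/-- The representations of `n` as a sum of four squares, the last two of the same parity. -/
noncomputable def evenPairReps (n : ℤ) : Finset (Fin 4 → ℤ) :=
  {v ∈ squareReps (Fin 4) n | Even (v 2 + v 3)}

/-- The triples `(k, d, e)` with `d, e > 0` and `k² + 4de = n`. -/
noncomputable def indefiniteForms (n : ℤ) : Finset (ℤ × ℤ × ℤ) :=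
  {t ∈ Icc (-n) n ×ˢ Icc 1 n ×ˢ Icc 1 n | t.1 ^ 2 + 4 * t.2.1 * t.2.2 = n}

/-- The sum of the positive divisors of `n`, which is zero if `n ≤ 0`. -/
def divisorSum (n : ℤ) : ℤ := ∑ d ∈ n.toNat.divisors, (d : ℤ)

section SquareReps

variable {ι : Type} [Fintype ι] [DecidableEq ι] {n : ℤ}

theorem mem_squareReps {v : ι → ℤ} : v ∈ squareReps ι n ↔ ∑ i, v i ^ 2 = n := by
  simp only [squareReps, mem_filter, Fintype.mem_piFinset, mem_Icc, and_iff_right_iff_imp]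
  intro h i
  have hi : v i ^ 2 ≤ n :=
    h ▸ single_le_sum (f := fun i => v i ^ 2) (fun i _ => sq_nonneg (v i)) (mem_univ i)
  have := Int.natAbs_le_self_sq (v i)
  omega

theorem mem_oddSquareReps {v : ι → ℤ} :
    v ∈ oddSquareReps ι n ↔ ∑ i, v i ^ 2 = n ∧ ∀ i, Odd (v i) := by
  simp [oddSquareReps, mem_squareReps]

theorem sum_oddSquareReps_sq (i j : ι) :
    ∑ v ∈ oddSquareReps ι n, v i ^ 2 = ∑ v ∈ oddSquareReps ι n, v j ^ 2 := by
  have h : ∀ v ∈ oddSquareReps ι n, v ∘ Equiv.swap i j ∈ oddSquareReps ι n := by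
    intro v hv
    rw [mem_oddSquareReps] at hv ⊢
    refine ⟨?_, fun l => hv.2 _⟩
    rw [← hv.1]
    exact Equiv.sum_comp (Equiv.swap i j) fun l => v l ^ 2
  refine sum_nbij' (fun v => v ∘ Equiv.swap i j) (fun v => v ∘ Equiv.swap i j) h h ?_ ?_ ?_
  · intro v _; ext l; simp
  · intro v _; ext l; simp
  · intro v _; simp

theorem sum_oddSquareReps_harmonic (i : ι) :
    ∑ v ∈ oddSquareReps ι n, (n - Fintype.card ι * v i ^ 2) = 0 := by
  have h : ∑ j : ι, ∑ v ∈ oddSquareReps ι n, v j ^ 2 = ∑ v ∈ oddSquareReps ι n, n := by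
    rw [sum_comm]
    exact sum_congr rfl fun v hv => (mem_oddSquareReps.1 hv).1
  rw [sum_congr rfl fun j _ => sum_oddSquareReps_sq j i] at h
  rw [sum_sub_distrib, ← mul_sum, ← h]
  simp

end SquareReps

theorem card_oddSquareReps_fiber (c : ℕ) (n k : ℤ) (hk : Odd k) :
    #{v ∈ oddSquareReps (Fin (c + 1)) n | v 0 = k} = #(oddSquareReps (Fin c) (n - k ^ 2)) := by
  refine card_nbij' Fin.tail (fun v => Fin.cons k v) ?_ ?_ ?_ ?_
  · intro v hv
    simp only [coe_filter, Set.mem_ofPred_eq, mem_oddSquareReps, Fin.sum_univ_succ] at hv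
    obtain ⟨⟨h, ho⟩, rfl⟩ := hv
    simp only [mem_coe, mem_oddSquareReps, Fin.tail]
    exact ⟨by linarith, fun i => ho _⟩
  · intro v hv
    simp only [mem_coe, mem_oddSquareReps] at hv
    simp only [coe_filter, Set.mem_ofPred_eq, mem_oddSquareReps, Fin.sum_univ_succ,
      Fin.forall_fin_succ, Fin.cons_zero, Fin.cons_succ]
    exact ⟨⟨by linarith, hk, hv.2⟩, trivial⟩
  · intro v hv
    simp only [coe_filter, Set.mem_ofPred_eq] at hv
    rw [← hv.2]
    exact Fin.cons_self_tail v
  · intro v _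
    exact Fin.tail_cons (α := fun _ => ℤ) k v

theorem sum_harmonic_mul_card_oddSquareReps (n : ℤ) :
    ∑ k ∈ Icc (-n) n with Odd k, (n - 5 * k ^ 2) * #(oddSquareReps (Fin 4) (n - k ^ 2)) = 0 := by
  have h := sum_oddSquareReps_harmonic (n := n) (0 : Fin 5)
  rw [← sum_fiberwise_of_maps_to (g := fun v => v 0) (t := {k ∈ Icc (-n) n | Odd k})] at h
  · rw [← h]
    refine sum_congr rfl fun k hk => ?_
    rw [← card_oddSquareReps_fiber 4 n k (mem_filter.1 hk).2, mul_comm, ← nsmul_eq_mul,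
      ← sum_const]
    refine sum_congr rfl fun v hv => ?_
    rw [(mem_filter.1 hv).2]
    simp
  · intro v hv
    simp only [oddSquareReps, squareReps, mem_filter, Fintype.mem_piFinset] at hv
    exact mem_filter.2 ⟨hv.1.1 0, hv.2 0⟩

theorem mem_indefiniteForms {n k d e : ℤ} :
    (k, d, e) ∈ indefiniteForms n ↔ 0 < d ∧ 0 < e ∧ k ^ 2 + 4 * d * e = n := by
  simp only [indefiniteForms, mem_filter, mem_product, mem_Icc]
  constructor
  · rintro ⟨⟨-, ⟨hd, -⟩, he, -⟩, h⟩
    exact ⟨hd, he, h⟩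
  · rintro ⟨hd, he, h⟩
    have := Int.natAbs_le_self_sq k
    have h1 : 0 < d * e := mul_pos hd he
    have h2 : d ≤ d * e := by nlinarith
    have h3 : e ≤ d * e := by nlinarith
    have h4 : (k ^ 2 : ℤ) = n - 4 * (d * e) := by linarith
    have := sq_nonneg k
    refine ⟨⟨⟨?_, ?_⟩, ⟨?_, ?_⟩, ?_, ?_⟩, h⟩ <;> omega

theorem sum_indefiniteForms_antisymm {n : ℤ} (hn : ¬ IsSquare n) :
    ∑ t ∈ indefiniteForms n, (t.2.1 + t.2.2) * (t.2.1 - t.1) * (t.2.2 + t.1) = 0 := by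
  have hU : ∑ t ∈ indefiniteForms n with t.1 + t.2.2 < t.2.1,
      (t.2.1 + t.2.2) * (t.2.1 - t.1) * (t.2.2 + t.1) = 0 := by
    have hφ : ∀ t ∈ {t ∈ indefiniteForms n | t.1 + t.2.2 < t.2.1},
        (-t.1 - 2 * t.2.2, t.2.1 - t.1 - t.2.2, t.2.2) ∈
          {t ∈ indefiniteForms n | t.1 + t.2.2 < t.2.1} := by
      rintro ⟨k, d, e⟩ h
      simp only [mem_filter, mem_indefiniteForms] at h ⊢
      obtain ⟨⟨hd, he, h⟩, hlt⟩ := h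
      exact ⟨⟨by linarith, he, by rw [← h]; ring⟩, by linarith⟩
    have h := sum_nbij' (s := {t ∈ indefiniteForms n | t.1 + t.2.2 < t.2.1})
      (f := fun t => (t.2.1 + t.2.2) * (t.2.1 - t.1) * (t.2.2 + t.1))
      (g := fun t => -((t.2.1 + t.2.2) * (t.2.1 - t.1) * (t.2.2 + t.1))) _ _ hφ hφ
      (by rintro ⟨k, d, e⟩ -; simp only [Prod.mk.injEq]; refine ⟨?_, ?_, trivial⟩ <;> ring)
      (by rintro ⟨k, d, e⟩ -; simp only [Prod.mk.injEq]; refine ⟨?_, ?_, trivial⟩ <;> ring)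
      (by rintro ⟨k, d, e⟩ -; ring)
    rw [sum_neg_distrib] at h
    linarith
  rw [← sum_filter_add_sum_filter_not _ fun t : ℤ × ℤ × ℤ => t.1 + t.2.2 < t.2.1, hU, zero_add,
    ← hU]
  refine sum_nbij' (fun t => (-t.1, t.2.2, t.2.1)) (fun t => (-t.1, t.2.2, t.2.1)) ?_ ?_ ?_ ?_ ?_
  · rintro ⟨k, d, e⟩ h
    simp only [mem_filter, mem_indefiniteForms] at h ⊢
    obtain ⟨⟨hd, he, h⟩, hlt⟩ := h
    have hne : k + e ≠ d := by
      rintro rfl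
      exact hn ⟨k + 2 * e, by rw [← h]; ring⟩
    exact ⟨⟨he, hd, by rw [← h]; ring⟩, by omega⟩
  · rintro ⟨k, d, e⟩ h
    simp only [mem_filter, mem_indefiniteForms] at h ⊢
    obtain ⟨⟨hd, he, h⟩, hlt⟩ := h
    exact ⟨⟨he, hd, by rw [← h]; ring⟩, by omega⟩
  · rintro ⟨k, d, e⟩ -; simp
  · rintro ⟨k, d, e⟩ -; simp
  · rintro ⟨k, d, e⟩ -; ring

theorem sum_indefiniteForms_harmonic {n : ℤ} (hn : ¬ IsSquare n) :
    ∑ t ∈ indefiniteForms n, (n - 5 * t.1 ^ 2) * t.2.2 = 0 := by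
  have hneg : ∑ t ∈ indefiniteForms n, (t.2.1 + t.2.2) * (t.2.1 + t.1) * (t.2.2 - t.1) = 0 := by
    rw [← sum_indefiniteForms_antisymm hn]
    refine sum_nbij' (fun t => (t.1, t.2.2, t.2.1)) (fun t => (t.1, t.2.2, t.2.1)) ?_ ?_ ?_ ?_ ?_
    · rintro ⟨k, d, e⟩ h
      rw [mem_indefiniteForms] at h ⊢
      exact ⟨h.2.1, h.1, by rw [← h.2.2]; ring⟩
    · rintro ⟨k, d, e⟩ h
      rw [mem_indefiniteForms] at h ⊢
      exact ⟨h.2.1, h.1, by rw [← h.2.2]; ring⟩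
    · rintro ⟨k, d, e⟩ -; simp
    · rintro ⟨k, d, e⟩ -; simp
    · rintro ⟨k, d, e⟩ -; ring
  have hswap : ∑ t ∈ indefiniteForms n, (n - 5 * t.1 ^ 2) * t.2.1 =
      ∑ t ∈ indefiniteForms n, (n - 5 * t.1 ^ 2) * t.2.2 := by
    refine sum_nbij' (fun t => (t.1, t.2.2, t.2.1)) (fun t => (t.1, t.2.2, t.2.1)) ?_ ?_ ?_ ?_ ?_
    · rintro ⟨k, d, e⟩ h
      rw [mem_indefiniteForms] at h ⊢
      exact ⟨h.2.1, h.1, by rw [← h.2.2]; ring⟩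
    · rintro ⟨k, d, e⟩ h
      rw [mem_indefiniteForms] at h ⊢
      exact ⟨h.2.1, h.1, by rw [← h.2.2]; ring⟩
    · rintro ⟨k, d, e⟩ -; simp
    · rintro ⟨k, d, e⟩ -; simp
    · rintro ⟨k, d, e⟩ -; ring
  have hsum : ∑ t ∈ indefiniteForms n, ((n - 5 * t.1 ^ 2) * t.2.1 + (n - 5 * t.1 ^ 2) * t.2.2) =
      ∑ t ∈ indefiniteForms n, (2 * ((t.2.1 + t.2.2) * (t.2.1 - t.1) * (t.2.2 + t.1)) +
        2 * ((t.2.1 + t.2.2) * (t.2.1 + t.1) * (t.2.2 - t.1))) := by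
    refine sum_congr rfl ?_
    rintro ⟨k, d, e⟩ h
    obtain ⟨-, -, h⟩ := mem_indefiniteForms.1 h
    simp only [← h]
    ring
  rw [sum_add_distrib, sum_add_distrib, ← mul_sum, ← mul_sum, hneg,
    sum_indefiniteForms_antisymm hn, hswap] at hsum
  linarith

theorem sum_indefiniteForms_fiber {n k j : ℤ} (hj : n - k ^ 2 = 4 * j) :
    ∑ t ∈ indefiniteForms n with t.1 = k, t.2.2 = divisorSum j := by
  refine sum_nbij' (fun t => t.2.2.toNat) (fun e => (k, j / e, (e : ℤ))) ?_ ?_ ?_ ?_ ?_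
  · rintro ⟨k, d, e⟩ h
    simp only [mem_filter, mem_indefiniteForms] at h
    obtain ⟨⟨hd, he, h⟩, rfl⟩ := h
    have hde : j = d * e := by linarith
    have := mul_pos hd he
    lift d to ℕ using hd.le
    lift e to ℕ using he.le
    subst hde
    rw [Nat.mem_divisors, ← Nat.cast_mul, Int.toNat_natCast, Int.toNat_natCast]
    exact ⟨Dvd.intro_left d rfl, by exact_mod_cast this.ne'⟩
  · intro e h
    obtain ⟨⟨d, hd⟩, h0⟩ := Nat.mem_divisors.1 h
    have hj0 : 0 < j := by omega
    have hde : j = e * d := by rw [← Int.toNat_of_nonneg hj0.le, hd, Nat.cast_mul]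
    have he : (0 : ℤ) < e := by
      rcases Nat.eq_zero_or_pos e with rfl | h
      · simp at hde; omega
      · exact_mod_cast h
    have hd0 : (0 : ℤ) < d := pos_of_mul_pos_right (hde ▸ hj0) he.le
    simp only [mem_filter, mem_indefiniteForms, and_true]
    rw [hde, Int.mul_ediv_cancel_left _ he.ne']
    exact ⟨hd0, he, by linarith⟩
  · rintro ⟨k, d, e⟩ h
    simp only [mem_filter, mem_indefiniteForms] at h
    obtain ⟨⟨hd, he, h⟩, rfl⟩ := h
    have hde : j = d * e := by linarith
    simp only [Int.toNat_of_nonneg he.le, hde, Int.mul_ediv_cancel _ he.ne']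
  · intro e _; simp
  · rintro ⟨k, d, e⟩ h
    simp only [mem_filter, mem_indefiniteForms] at h
    exact (Int.toNat_of_nonneg h.1.2.1.le).symm

theorem sum_harmonic_mul_divisorSum {m : ℤ} (hm : Odd m) :
    ∑ k ∈ Icc (-(4 * m + 1)) (4 * m + 1) with Odd k,
      (4 * m + 1 - 5 * k ^ 2) * divisorSum ((4 * m + 1 - k ^ 2) / 4) = 0 := by
  have hn : ¬ IsSquare (4 * m + 1) := by
    rintro ⟨s, hs⟩
    have hs' : Odd s := by
      rw [← Int.not_even_iff_odd]
      rintro ⟨l, rfl⟩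
      ring_nf at hs
      omega
    have h8 := Int.eight_dvd_sq_sub_one_of_odd hs'
    rw [sq, ← hs] at h8
    obtain ⟨l, rfl⟩ := hm
    omega
  rw [← sum_indefiniteForms_harmonic hn, ← sum_fiberwise_of_maps_to (g := fun t : ℤ × ℤ × ℤ => t.1)
    (t := {k ∈ Icc (-(4 * m + 1)) (4 * m + 1) | Odd k})]
  · refine sum_congr rfl fun k hk => ?_
    obtain ⟨l, hl⟩ := (mem_filter.1 hk).2
    have hj : 4 * m + 1 - k ^ 2 = 4 * (m - l ^ 2 - l) := by rw [hl]; ring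
    rw [← sum_indefiniteForms_fiber (n := 4 * m + 1) (k := k), mul_sum]
    · refine sum_congr rfl fun t ht => ?_
      rw [(mem_filter.1 ht).2]
    · rw [hj, Int.mul_ediv_cancel_left _ four_ne_zero]
  · rintro ⟨k, d, e⟩ h
    refine mem_filter.2 ⟨(mem_product.1 (mem_filter.1 h).1).1, ?_⟩
    obtain ⟨-, -, h⟩ := mem_indefiniteForms.1 h
    rw [← Int.not_even_iff_odd]
    rintro ⟨l, rfl⟩
    ring_nf at h
    omega

theorem sq_pos_of_odd {x : ℤ} (hx : Odd x) : 0 < x ^ 2 := by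
  have : x ≠ 0 := fun h => by simp [h] at hx
  positivity

theorem card_oddSquareReps_four : #(oddSquareReps (Fin 4) 4) = 16 := by
  have : oddSquareReps (Fin 4) 4 = Fintype.piFinset fun _ => {1, -1} := by
    ext v
    simp only [mem_oddSquareReps, Fintype.mem_piFinset, mem_insert, mem_singleton]
    constructor
    · rintro ⟨h, ho⟩ i
      have hpos (i : Fin 4) : 0 < v i ^ 2 := sq_pos_of_odd (ho i)
      rw [← sq_eq_one_iff]
      rw [Fin.sum_univ_four] at h
      have := hpos 0
      have := hpos 1
      have := hpos 2
      have := hpos 3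
      fin_cases i <;> simp only [Fin.zero_eta, Fin.mk_one, Fin.reduceFinMk] <;> omega
    · intro h
      have h1 (i : Fin 4) : v i ^ 2 = 1 := by rcases h i with h | h <;> simp [h]
      refine ⟨by simp [h1], fun i => ?_⟩
      rcases h i with h | h <;> simp [h]
  rw [this, Fintype.card_piFinset]
  rfl

theorem card_oddSquareReps_of_le {j : ℤ} (hj : j < 4) : #(oddSquareReps (Fin 4) j) = 0 := by
  rw [card_eq_zero, eq_empty_iff_forall_notMem]
  intro v hv
  obtain ⟨h, ho⟩ := mem_oddSquareReps.1 hv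
  have hpos (i : Fin 4) : 0 < v i ^ 2 := sq_pos_of_odd (ho i)
  rw [Fin.sum_univ_four] at h
  have := hpos 0
  have := hpos 1
  have := hpos 2
  have := hpos 3
  omega

theorem card_oddSquareReps_eq {m : ℤ} (hm : Odd m) :
    (#(oddSquareReps (Fin 4) (4 * m)) : ℤ) = 16 * divisorSum m := by
  induction hN : m.toNat using Nat.strong_induction_on generalizing m with
  | _ N ih =>
  rcases le_or_gt m 0 with h0 | h0
  · rw [card_oddSquareReps_of_le (by linarith)]
    simp [divisorSum, Int.toNat_of_nonpos h0]
  rcases eq_or_ne m 1 with rfl | h1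
  · rw [mul_one, card_oddSquareReps_four]
    simp [divisorSum]
  have hsum : ∑ k ∈ Icc (-(4 * m + 1)) (4 * m + 1) with Odd k, (4 * m + 1 - 5 * k ^ 2) *
      (#(oddSquareReps (Fin 4) (4 * m + 1 - k ^ 2)) -
        16 * divisorSum ((4 * m + 1 - k ^ 2) / 4)) = 0 := by
    have h := sum_harmonic_mul_divisorSum hm
    have h' := sum_harmonic_mul_card_oddSquareReps (4 * m + 1)
    simp only [mul_sub, sum_sub_distrib] at h h' ⊢
    simp only [mul_left_comm _ (16 : ℤ), ← mul_sum]
    linarith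
  rw [← sum_subset (s₁ := {1, -1})] at hsum
  · rw [sum_pair (by norm_num)] at hsum
    have hq : 4 * m + 1 - 1 ^ 2 = 4 * m := by ring
    have hq' : 4 * m + 1 - (-1) ^ 2 = 4 * m := by ring
    rw [hq, hq', Int.mul_ediv_cancel_left _ four_ne_zero] at hsum
    have hz : (8 * (m - 1)) * (#(oddSquareReps (Fin 4) (4 * m)) - 16 * divisorSum m) = 0 := by
      linarith
    rcases mul_eq_zero.1 hz with h | h <;> omega
  · intro k hk
    rw [mem_insert, mem_singleton] at hk
    rcases hk with rfl | rfl
    · simp; omega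
    · simp; omega
  · intro k hk hk1
    obtain ⟨l, hl⟩ := (mem_filter.1 hk).2
    have hj : 4 * m + 1 - k ^ 2 = 4 * (m - l * (l + 1)) := by rw [hl]; ring
    simp only [mem_insert, mem_singleton, not_or] at hk1
    have hpos : 0 < l * (l + 1) := by
      rcases lt_or_gt_of_ne (show l ≠ 0 by omega) with h | h
      · exact mul_pos_of_neg_of_neg h (by omega)
      · positivity
    rw [hj, Int.mul_ediv_cancel_left _ four_ne_zero,
      ih _ (by omega) (hm.sub_even (Int.even_mul_succ_self l)) rfl, sub_self, mul_zero]

theorem exists_sq_eq_four_mul_add_emod_two (x : ℤ) : ∃ q, x ^ 2 = 4 * q + x % 2 := by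
  rcases Int.even_or_odd' x with ⟨a, rfl | rfl⟩
  · exact ⟨a ^ 2, by rw [Int.mul_emod_right]; ring⟩
  · exact ⟨a ^ 2 + a, by rw [show (2 * a + 1) % 2 = 1 by omega]; ring⟩

/-- A sum of four squares is congruent modulo 4 to the number of its odd terms. -/
theorem exists_eq_four_mul_add_of_mem_squareReps {n : ℤ} {v : Fin 4 → ℤ}
    (hv : v ∈ squareReps (Fin 4) n) :
    ∃ q, n = 4 * q + (v 0 % 2 + v 1 % 2 + v 2 % 2 + v 3 % 2) := by
  rw [mem_squareReps, Fin.sum_univ_four] at hv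
  obtain ⟨a, ha⟩ := exists_sq_eq_four_mul_add_emod_two (v 0)
  obtain ⟨b, hb⟩ := exists_sq_eq_four_mul_add_emod_two (v 1)
  obtain ⟨c, hc⟩ := exists_sq_eq_four_mul_add_emod_two (v 2)
  obtain ⟨d, hd⟩ := exists_sq_eq_four_mul_add_emod_two (v 3)
  exact ⟨a + b + c + d, by linarith⟩

theorem card_squareReps_filter_even_add (n : ℤ) (e : Equiv.Perm (Fin 4)) :
    #{v ∈ squareReps (Fin 4) n | Even (v (e 2) + v (e 3))} = #(evenPairReps n) := by
  have h (e : Equiv.Perm (Fin 4)) (v : Fin 4 → ℤ) :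
      v ∘ e ∈ squareReps (Fin 4) n ↔ v ∈ squareReps (Fin 4) n := by
    rw [mem_squareReps, mem_squareReps, ← Equiv.sum_comp e fun i => v i ^ 2]
    rfl
  refine card_nbij' (fun v => v ∘ e) (fun v => v ∘ e.symm) ?_ ?_ ?_ ?_
  · intro v hv
    simpa [evenPairReps, h] using hv
  · intro v hv
    simpa [evenPairReps, h] using hv
  · intro v _; ext i; simp
  · intro v _; ext i; simp

theorem card_squareReps_eq_of_odd {n : ℤ} (hn : Odd n) :
    #(squareReps (Fin 4) n) = 2 * #(evenPairReps n) := by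
  have h := card_squareReps_filter_even_add n (Equiv.swap 0 2 * Equiv.swap 1 3)
  rw [show (Equiv.swap 0 2 * Equiv.swap 1 3 : Equiv.Perm (Fin 4)) 2 = 0 by decide,
    show (Equiv.swap 0 2 * Equiv.swap 1 3 : Equiv.Perm (Fin 4)) 3 = 1 by decide] at h
  rw [two_mul]
  nth_rewrite 1 [← h]
  rw [evenPairReps, card_filter, card_filter, ← sum_add_distrib, card_eq_sum_ones]
  refine sum_congr rfl fun v hv => ?_
  obtain ⟨q, hq⟩ := exists_eq_four_mul_add_of_mem_squareReps hv
  rw [Int.odd_iff] at hn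
  simp only [Int.even_iff]
  split_ifs <;> omega

theorem card_squareReps_two_mul {n : ℤ} (hn : Odd n) :
    #(squareReps (Fin 4) (2 * n)) = 3 * #(evenPairReps (2 * n)) := by
  have h := card_squareReps_filter_even_add (2 * n) (Equiv.swap 1 2)
  have h' := card_squareReps_filter_even_add (2 * n) (Equiv.swap 1 3)
  rw [show (Equiv.swap 1 2 : Equiv.Perm (Fin 4)) 2 = 1 by decide,
    show (Equiv.swap 1 2 : Equiv.Perm (Fin 4)) 3 = 3 by decide] at h
  rw [show (Equiv.swap 1 3 : Equiv.Perm (Fin 4)) 2 = 2 by decide,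
    show (Equiv.swap 1 3 : Equiv.Perm (Fin 4)) 3 = 1 by decide] at h'
  have hsum : #(squareReps (Fin 4) (2 * n)) =
      #{v ∈ squareReps (Fin 4) (2 * n) | Even (v 1 + v 3)} +
        #{v ∈ squareReps (Fin 4) (2 * n) | Even (v 2 + v 1)} + #(evenPairReps (2 * n)) := by
    rw [evenPairReps, card_filter, card_filter, card_filter, ← sum_add_distrib,
      ← sum_add_distrib, card_eq_sum_ones]
    refine sum_congr rfl fun v hv => ?_
    obtain ⟨q, hq⟩ := exists_eq_four_mul_add_of_mem_squareReps hv
    rw [Int.odd_iff] at hn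
    simp only [Int.even_iff]
    split_ifs <;> omega
  omega

theorem evenPairReps_four_mul (n : ℤ) : evenPairReps (4 * n) = squareReps (Fin 4) (4 * n) := by
  refine filter_true_of_mem fun v hv => ?_
  obtain ⟨q, hq⟩ := exists_eq_four_mul_add_of_mem_squareReps hv
  rw [Int.even_iff]
  omega

theorem card_evenPairReps_two_mul (n : ℤ) :
    #(evenPairReps (2 * n)) = #(squareReps (Fin 4) n) := by
  have hpar {v : Fin 4 → ℤ} (hv : v ∈ evenPairReps (2 * n)) :
      ∃ a b c d : ℤ, v = ![a + b, a - b, c + d, c - d] := by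
    obtain ⟨hv, he⟩ := mem_filter.1 hv
    obtain ⟨q, hq⟩ := exists_eq_four_mul_add_of_mem_squareReps hv
    rw [Int.even_iff] at he
    refine ⟨(v 0 + v 1) / 2, (v 0 - v 1) / 2, (v 2 + v 3) / 2, (v 2 - v 3) / 2, ?_⟩
    ext i
    fin_cases i <;> simp <;> omega
  symm
  refine card_nbij (fun v => ![v 0 + v 1, v 0 - v 1, v 2 + v 3, v 2 - v 3]) ?_ ?_ ?_
  · intro v hv
    rw [mem_coe, mem_squareReps, Fin.sum_univ_four] at hv
    simp only [evenPairReps, coe_filter, mem_squareReps, Fin.sum_univ_four, Set.mem_ofPred_eq,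
      Matrix.cons_val]
    exact ⟨by rw [← hv]; ring, v 2, by ring⟩
  · intro v _ w _ h
    have h0 := congrFun h 0
    have h1 := congrFun h 1
    have h2 := congrFun h 2
    have h3 := congrFun h 3
    simp only [Matrix.cons_val] at h0 h1 h2 h3
    ext i
    fin_cases i <;> simp <;> omega
  · intro v hv
    obtain ⟨a, b, c, d, rfl⟩ := hpar hv
    refine ⟨![a, b, c, d], ?_, by simp⟩
    simp only [evenPairReps, coe_filter, mem_squareReps, Fin.sum_univ_four, Set.mem_ofPred_eq,
      Matrix.cons_val] at hv
    simp only [mem_coe, mem_squareReps, Fin.sum_univ_four, Matrix.cons_val]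
    linarith [hv.1]

theorem card_squareReps_four_mul (n : ℤ) :
    #(squareReps (Fin 4) (4 * n)) = #(oddSquareReps (Fin 4) (4 * n)) + #(squareReps (Fin 4) n) := by
  rw [oddSquareReps, ← card_filter_add_card_filter_not (s := squareReps (Fin 4) (4 * n))
    (fun v => ∀ i, Odd (v i))]
  congr 1
  · congr
  symm
  refine card_nbij (fun v i => 2 * v i) ?_ ?_ ?_
  · intro v hv
    rw [mem_coe, mem_squareReps] at hv
    simp only [coe_filter, mem_squareReps, Set.mem_ofPred_eq, mul_pow, ← mul_sum, hv]
    refine ⟨by ring, fun h => ?_⟩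
    exact Int.not_odd_iff_even.2 (even_two_mul (v 0)) (h 0)
  · intro v _ w _ h
    ext i
    simpa using congrFun h i
  · intro v hv
    obtain ⟨hv, ho⟩ := mem_filter.1 hv
    obtain ⟨q, hq⟩ := exists_eq_four_mul_add_of_mem_squareReps hv
    obtain ⟨j, hj⟩ := not_forall.1 ho
    rw [Int.odd_iff] at hj
    have he : ∀ i, 2 * (v i / 2) = v i := by
      intro i
      fin_cases j <;> fin_cases i <;>
        simp only [Fin.zero_eta, Fin.mk_one, Fin.reduceFinMk] at hj ⊢ <;> omega
    refine ⟨fun i => v i / 2, ?_, funext he⟩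
    have h : ∑ i, (2 * (v i / 2)) ^ 2 = 4 * n := by simpa only [he] using mem_squareReps.1 hv
    simp only [mul_pow, ← mul_sum] at h
    rw [mem_coe, mem_squareReps]
    linarith

theorem natCard_form_eq_card_evenPairReps (n : ℤ) :
    Nat.card {v : ℤ × ℤ × ℤ × ℤ //
        v.1 ^ 2 + v.2.1 ^ 2 + 2 * v.2.2.1 ^ 2 + 2 * v.2.2.2 ^ 2 = n} = #(evenPairReps n) := by
  rw [← Nat.card_eq_finsetCard]
  refine Nat.card_eq_of_bijective (fun v => ⟨![v.1.1, v.1.2.1, v.1.2.2.1 + v.1.2.2.2,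
    v.1.2.2.1 - v.1.2.2.2], ?_⟩) ⟨?_, ?_⟩
  · simp only [evenPairReps, mem_filter, mem_squareReps, Fin.sum_univ_four, Matrix.cons_val]
    exact ⟨by linarith [v.2], v.1.2.2.1, by ring⟩
  · rintro ⟨⟨x, y, z, w⟩, hv⟩ ⟨⟨x', y', z', w'⟩, hv'⟩ h
    simp at h ⊢
    omega
  · rintro ⟨v, hv⟩
    have hv' := hv
    simp only [evenPairReps, mem_filter, mem_squareReps, Fin.sum_univ_four] at hv'
    obtain ⟨h, c, hc⟩ := hv'
    have h3 : v 3 = c - (v 2 - c) := by linarith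
    refine ⟨⟨(v 0, v 1, c, v 2 - c), ?_⟩, ?_⟩
    · rw [h3] at h
      linarith
    · ext i
      fin_cases i <;> simp
      omega

/-- **Jacobi's four-square theorem** for odd integers. -/
theorem card_squareReps_of_odd {m : ℕ} (hm : Odd m) :
    #(squareReps (Fin 4) m) = 8 * ∑ d ∈ m.divisors, d := by
  have hm' : Odd (m : ℤ) := by exact_mod_cast hm
  have h1 := card_oddSquareReps_eq hm'
  have h2 := card_squareReps_four_mul m
  have h3 := card_evenPairReps_two_mul (2 * m)
  have h4 := card_evenPairReps_two_mul m
  have h5 := card_squareReps_two_mul hm'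
  rw [← mul_assoc, show (2 * 2 : ℤ) = 4 by norm_num, evenPairReps_four_mul] at h3
  rw [divisorSum, Int.toNat_natCast, ← Nat.cast_sum] at h1
  omega

theorem card_evenPairReps_two_pow_mul {m : ℕ} (hm : Odd m) (r : ℕ) :
    #(evenPairReps (2 ^ (r + 2) * m)) = 24 * ∑ d ∈ m.divisors, d := by
  induction r with
  | zero =>
    have hm' : Odd (m : ℤ) := by exact_mod_cast hm
    have h4 := card_evenPairReps_two_mul m
    rw [show (2 ^ (0 + 2) * m : ℤ) = 2 * (2 * m) by ring, card_evenPairReps_two_mul,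
      card_squareReps_two_mul hm', h4, card_squareReps_of_odd hm]
    ring
  | succ r ih =>
    rw [show (2 ^ (r + 1 + 2) * m : ℤ) = 2 * (4 * (2 ^ r * m)) by ring, card_evenPairReps_two_mul,
      ← evenPairReps_four_mul, ← ih]
    congr 2
    ring

/-- The number of representations of `n = 2^r·m` (with `m` odd) by the quadratic form
`x² + y² + 2z² + 2w²` is `4σ(m)` if `r = 0`, `8σ(m)` if `r = 1`, and `24σ(m)` if `r ≥ 2`,
where `σ(m) = ∑_{d ∣ m} d`. -/
theorem representation_count_of_form (n r m : ℕ) (hn : 0 < n) (hm : Odd m)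
    (hfac : n = 2 ^ r * m) :
    Nat.card {v : ℤ × ℤ × ℤ × ℤ //
        v.1 ^ 2 + v.2.1 ^ 2 + 2 * v.2.2.1 ^ 2 + 2 * v.2.2.2 ^ 2 = (n : ℤ)} =
      (if r = 0 then 4 else if r = 1 then 8 else 24) * ∑ d ∈ m.divisors, d := by
  rw [natCard_form_eq_card_evenPairReps, hfac]
  have h := card_squareReps_of_odd hm
  match r with
  | 0 =>
    have h' := card_squareReps_eq_of_odd (n := m) (by exact_mod_cast hm)
    simp only [pow_zero, one_mul, if_true]
    omega
  | 1 =>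
    have h' := card_evenPairReps_two_mul m
    simp only [pow_one, Nat.cast_mul, Nat.cast_ofNat, one_ne_zero, if_false, if_true]
    omega
  | r + 2 =>
    have h' := card_evenPairReps_two_pow_mul hm r
    simpa using h'
end

section
/- Let m be an odd positive integer. The number of quadruples (x, y, z, w) ∈ ℤ⁴ with x² + y² + 2z² + 2w² = 4m such that x and y are even and z and w are odd equals 4σ(m). -/
open Finset

/-- The integer solutions of `x² + y² = n`. -/
noncomputable def twoSquareReps (n : ℕ) : Finset (ℤ × ℤ) :=
  {v ∈ Icc (-n : ℤ) n ×ˢ Icc (-n : ℤ) n | v.1 ^ 2 + v.2 ^ 2 = n}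

lemma mem_twoSquareReps {n : ℕ} {v : ℤ × ℤ} :
    v ∈ twoSquareReps n ↔ v.1 ^ 2 + v.2 ^ 2 = n := by
  simp only [twoSquareReps, mem_filter, mem_product, mem_Icc, and_iff_right_iff_imp]
  intro h
  have key : ∀ a b : ℤ, a ^ 2 + b ^ 2 = n → -(n : ℤ) ≤ a ∧ a ≤ n := fun a b hab => by
    have := Int.le_self_sq a
    have := Int.le_self_sq (-a)
    constructor <;> nlinarith [sq_nonneg b]
  exact ⟨key _ _ h, key _ _ (by rw [add_comm]; exact h)⟩

/-- The sum of `χ₄` over the divisors of `n`. -/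
noncomputable def chiDivisorSum (n : ℕ) : ℤ := ∑ d ∈ n.divisors, ZMod.χ₄ d

lemma chiDivisorSum_mul_of_not_dvd {p k : ℕ} (hp : p.Prime) (h : ¬ p ∣ k) :
    chiDivisorSum (p * k) = (1 + ZMod.χ₄ p) * chiDivisorSum k := by
  have hc : Nat.Coprime p k := (Nat.Prime.coprime_iff_not_dvd hp).2 h
  have e : (p * k).divisors = k.divisors ∪ k.divisors.image (p * ·) := by
    rw [Nat.divisors_mul, hp.divisors]
    ext x
    simp [Finset.mem_mul]
  have hd : Disjoint k.divisors (k.divisors.image (p * ·)) := by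
    rw [Finset.disjoint_left]
    intro x hx hx'
    obtain ⟨y, -, rfl⟩ := mem_image.1 hx'
    exact h ((Dvd.intro _ rfl).trans (Nat.dvd_of_mem_divisors hx))
  rw [chiDivisorSum, e, sum_union hd,
    sum_image (fun _ _ _ _ hab => Nat.eq_of_mul_eq_mul_left hp.pos hab)]
  simp only [Nat.cast_mul, map_mul, ← mul_sum]
  rw [chiDivisorSum]; ring

lemma chiDivisorSum_mul_mul {p k : ℕ} (hp : p.Prime) (hk : k ≠ 0) :
    chiDivisorSum (p * (p * k)) + ZMod.χ₄ p * chiDivisorSum k =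
      (1 + ZMod.χ₄ p) * chiDivisorSum (p * k) := by
  have e : (p * (p * k)).divisors = (p * k).divisors ∪ (p * k).divisors.image (p * ·) := by
    rw [Nat.divisors_mul, hp.divisors]
    ext x
    simp [Finset.mem_mul]
  have hi : (p * k).divisors ∩ (p * k).divisors.image (p * ·) = k.divisors.image (p * ·) := by
    ext x
    simp only [mem_inter, mem_image, Nat.mem_divisors]
    constructor
    · rintro ⟨⟨h1, h2⟩, y, -, rfl⟩
      exact ⟨y, ⟨Nat.dvd_of_mul_dvd_mul_left hp.pos h1, hk⟩, rfl⟩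
    · rintro ⟨y, ⟨h1, -⟩, rfl⟩
      have := mul_ne_zero hp.ne_zero hk
      exact ⟨⟨mul_dvd_mul_left p h1, this⟩, y, ⟨h1.mul_left p, this⟩, rfl⟩
  have inj : ∀ n : ℕ, ∑ d ∈ n.divisors.image (p * ·), ZMod.χ₄ d = ZMod.χ₄ p * chiDivisorSum n := by
    intro n
    rw [sum_image (fun _ _ _ _ hab => Nat.eq_of_mul_eq_mul_left hp.pos hab)]
    simp only [Nat.cast_mul, map_mul, ← mul_sum, chiDivisorSum]
  have := sum_union_inter (s₁ := (p * k).divisors) (s₂ := (p * k).divisors.image (p * ·))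
    (f := fun d : ℕ => ZMod.χ₄ d)
  rw [hi, ← e, inj, inj] at this
  rw [chiDivisorSum, this, chiDivisorSum]; ring

/-- The solutions of `x² + y² = n` with both coordinates divisible by `p`. -/
noncomputable def divisibleReps (p n : ℕ) : Finset (ℤ × ℤ) :=
  {v ∈ twoSquareReps n | (p : ℤ) ∣ v.1 ∧ (p : ℤ) ∣ v.2}

lemma divisibleReps_eq_empty {p k : ℕ} (hp : p.Prime) (h : ¬ p ∣ k) :
    divisibleReps p (p * k) = ∅ := by
  refine filter_eq_empty_iff.2 ?_
  rintro ⟨x, y⟩ hv ⟨⟨a, rfl⟩, ⟨b, rfl⟩⟩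
  have hv := mem_twoSquareReps.1 hv
  push_cast at hv
  apply h
  have hp0 : (p : ℤ) ≠ 0 := by exact_mod_cast hp.ne_zero
  have : (k : ℤ) = p * (a ^ 2 + b ^ 2) := mul_left_cancel₀ hp0 (by linarith)
  exact Int.natCast_dvd_natCast.1 ⟨_, this⟩

lemma card_divisibleReps {p k : ℕ} (hp : p.Prime) :
    #(divisibleReps p (p * (p * k))) = #(twoSquareReps k) := by
  have hp0 : (p : ℤ) ≠ 0 := by exact_mod_cast hp.ne_zero
  symm
  refine card_bij (fun v _ => (p * v.1, p * v.2)) ?_ ?_ ?_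
  · intro v hv
    have hv := mem_twoSquareReps.1 hv
    simp only [divisibleReps, mem_filter, mem_twoSquareReps, dvd_mul_right, and_true]
    push_cast
    rw [← hv]; ring
  · intro v _ w _ h
    simpa [hp.ne_zero, Prod.ext_iff] using h
  · rintro ⟨x, y⟩ hv
    simp only [divisibleReps, mem_filter, mem_twoSquareReps] at hv
    obtain ⟨hv, ⟨a, rfl⟩, b, rfl⟩ := hv
    refine ⟨(a, b), mem_twoSquareReps.2 ?_, rfl⟩
    push_cast at hv
    exact mul_left_cancel₀ (mul_ne_zero hp0 hp0) (by linarith)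

lemma twoSquareReps_eq_divisibleReps {p n : ℕ} (hp : p.Prime) (h3 : p % 4 = 3) (h : p ∣ n) :
    twoSquareReps n = divisibleReps p n := by
  refine (filter_true_of_mem fun v hv => ?_).symm
  have hv := mem_twoSquareReps.1 hv
  have := Fact.mk hp
  have key : ∀ a b : ℤ, a ^ 2 + b ^ 2 = n → (p : ℤ) ∣ b := fun a b hab => by
    by_contra hb
    rw [← ZMod.intCast_zmod_eq_zero_iff_dvd] at hb
    have e : (a : ZMod p) ^ 2 + (b : ZMod p) ^ 2 = 0 := by
      have := congrArg (Int.cast : ℤ → ZMod p) hab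
      push_cast at this
      rw [this, ZMod.natCast_eq_zero_iff]
      exact h
    refine ZMod.mod_four_ne_three_of_sq_eq_neg_sq' (p := p) (x := (a : ZMod p)) hb ?_ h3
    linear_combination e
  exact ⟨key _ _ (by rw [add_comm]; exact hv), key _ _ hv⟩

lemma card_filter_dvd {p n : ℕ} {s t : ℤ} (hp : p.Prime) (hst : s ^ 2 + t ^ 2 = p) :
    #{v ∈ twoSquareReps (p * n) | (p : ℤ) ∣ v.1 * s + v.2 * t} = #(twoSquareReps n) := by
  have hp0 : (p : ℤ) ≠ 0 := by exact_mod_cast hp.ne_zero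
  symm
  refine card_bij (fun v _ => (v.1 * s + v.2 * t, v.1 * t - v.2 * s)) ?_ ?_ ?_
  · intro v hv
    have hv := mem_twoSquareReps.1 hv
    simp only [mem_filter, mem_twoSquareReps]
    push_cast
    refine ⟨?_, v.1, ?_⟩
    · rw [← hv, ← hst]; ring
    · rw [← hst]; ring
  · rintro ⟨a, b⟩ _ ⟨c, d⟩ _ h
    simp only [Prod.mk.injEq] at h ⊢
    obtain ⟨h1, h2⟩ := h
    constructor <;> apply mul_left_cancel₀ hp0 <;> rw [← hst]
    · linear_combination s * h1 + t * h2
    · linear_combination t * h1 - s * h2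
  · rintro ⟨x, y⟩ hv
    simp only [mem_filter, mem_twoSquareReps] at hv
    obtain ⟨hv, k, hk⟩ := hv
    push_cast at hv
    have hl : (p : ℤ) ∣ x * t - y * s := by
      refine (Nat.prime_iff_prime_int.1 hp).dvd_of_dvd_pow (n := 2) ⟨p * n - p * k ^ 2, ?_⟩
      linear_combination (s ^ 2 + t ^ 2) * hv + p * n * hst - (x * s + y * t + p * k) * hk
    obtain ⟨l, hl⟩ := hl
    refine ⟨(k, l), mem_twoSquareReps.2 ?_, ?_⟩
    · apply mul_left_cancel₀ (mul_ne_zero hp0 hp0)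
      linear_combination (s ^ 2 + t ^ 2) * hv + p * n * hst - (x * s + y * t + p * k) * hk
        - (x * t - y * s + p * l) * hl
    · simp only [Prod.mk.injEq]
      constructor <;> apply mul_left_cancel₀ hp0
      · linear_combination (-s) * hk - t * hl + x * hst
      · linear_combination (-t) * hk + s * hl + y * hst

lemma card_twoSquareReps_mul_add {p n : ℕ} (hp : p.Prime) (h1 : p % 4 = 1) :
    #(twoSquareReps (p * n)) + #(divisibleReps p (p * n)) = 2 * #(twoSquareReps n) := by
  have := Fact.mk hp
  obtain ⟨s, t, hst⟩ := Nat.Prime.sq_add_sq (p := p) (by omega)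
  have hst : (s : ℤ) ^ 2 + (t : ℤ) ^ 2 = p := by exact_mod_cast hst
  have hst' : (s : ℤ) ^ 2 + (-t : ℤ) ^ 2 = p := by linear_combination hst
  have hpp := Nat.prime_iff_prime_int.1 hp
  have hp0 : (p : ℤ) ≠ 0 := by exact_mod_cast hp.ne_zero
  have hu : ({v ∈ twoSquareReps (p * n) | (p : ℤ) ∣ v.1 * s + v.2 * t} ∪
      {v ∈ twoSquareReps (p * n) | (p : ℤ) ∣ v.1 * s + v.2 * (-t)}) = twoSquareReps (p * n) := by
    rw [← filter_or]
    refine filter_true_of_mem fun v hv => hpp.dvd_or_dvd ?_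
    have hv := mem_twoSquareReps.1 hv
    push_cast at hv
    exact ⟨v.1 ^ 2 - t ^ 2 * n, by linear_combination v.1 ^ 2 * hst - t ^ 2 * hv⟩
  have h2 : ¬ (p : ℤ) ∣ 2 := fun h => by
    have := Nat.le_of_dvd two_pos (Int.natCast_dvd_natCast.1 (by exact_mod_cast h))
    have := hp.two_le
    omega
  have hs : ∀ a b : ℤ, a ^ 2 + b ^ 2 = p → ¬ (p : ℤ) ∣ a := by
    intro a b hab ha
    have hb : (p : ℤ) ∣ b := by
      refine hpp.dvd_of_dvd_pow (n := 2) ?_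
      rw [show b ^ 2 = p - a ^ 2 by linarith]
      exact dvd_sub dvd_rfl (dvd_pow ha two_ne_zero)
    obtain ⟨a, rfl⟩ := ha
    obtain ⟨b, rfl⟩ := hb
    exact hpp.not_dvd_one ⟨a ^ 2 + b ^ 2, mul_left_cancel₀ hp0 (by linarith)⟩
  have hi : ({v ∈ twoSquareReps (p * n) | (p : ℤ) ∣ v.1 * s + v.2 * t} ∩
      {v ∈ twoSquareReps (p * n) | (p : ℤ) ∣ v.1 * s + v.2 * (-t)}) = divisibleReps p (p * n) := by
    rw [← filter_and]
    refine filter_congr fun v _ => ⟨fun ⟨ha, hb⟩ => ?_, fun ⟨ha, hb⟩ => ?_⟩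
    · have e1 := dvd_add ha hb
      have e2 := dvd_sub ha hb
      rw [show v.1 * s + v.2 * t + (v.1 * s + v.2 * (-t)) = 2 * (v.1 * s) by ring] at e1
      rw [show v.1 * s + v.2 * t - (v.1 * s + v.2 * (-t)) = 2 * (v.2 * t) by ring] at e2
      exact ⟨((hpp.dvd_or_dvd ((hpp.dvd_or_dvd e1).resolve_left h2))).resolve_right (hs _ _ hst),
        ((hpp.dvd_or_dvd ((hpp.dvd_or_dvd e2).resolve_left h2))).resolve_right
          (hs _ s (by linarith))⟩
    · exact ⟨dvd_add (ha.mul_right _) (hb.mul_right _), dvd_add (ha.mul_right _) (hb.mul_right _)⟩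
  have := card_union_add_card_inter
    {v ∈ twoSquareReps (p * n) | (p : ℤ) ∣ v.1 * s + v.2 * t}
    {v ∈ twoSquareReps (p * n) | (p : ℤ) ∣ v.1 * s + v.2 * (-t)}
  rw [hu, hi, card_filter_dvd hp hst, card_filter_dvd hp hst'] at this
  omega

/-- Jacobi's two-square theorem for odd numbers. -/
theorem card_twoSquareReps {n : ℕ} (hn : Odd n) :
    (#(twoSquareReps n) : ℤ) = 4 * chiDivisorSum n := by
  induction n using Nat.strong_induction_on with
  | _ n ih =>
    rcases eq_or_ne n 1 with rfl | h1
    · decide +kernel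
    obtain ⟨p, hp, k, rfl⟩ := Nat.exists_prime_and_dvd h1
    obtain ⟨hpo, hko⟩ := Nat.odd_mul.1 hn
    have hk0 : k ≠ 0 := hko.pos.ne'
    have hk := ih k (lt_mul_of_one_lt_left hko.pos hp.one_lt) hko
    have hdiv : (#(divisibleReps p (p * k)) : ℤ) =
        4 * ((1 + ZMod.χ₄ p) * chiDivisorSum k - chiDivisorSum (p * k)) * ZMod.χ₄ p := by
      by_cases h : p ∣ k
      · obtain ⟨j, rfl⟩ := h
        obtain ⟨-, hjo⟩ := Nat.odd_mul.1 hko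
        have hlt : j < p * (p * j) :=
          (lt_mul_of_one_lt_left hjo.pos hp.one_lt).trans (lt_mul_of_one_lt_left hko.pos hp.one_lt)
        rw [card_divisibleReps hp, ih j hlt hjo, ← chiDivisorSum_mul_mul hp hjo.pos.ne']
        have : ZMod.χ₄ p * ZMod.χ₄ p = 1 := by
          rcases Nat.odd_mod_four_iff.1 (Nat.odd_iff.1 hpo) with h | h
          · simp [ZMod.χ₄_nat_one_mod_four h]
          · simp [ZMod.χ₄_nat_three_mod_four h]
        linear_combination (-4) * chiDivisorSum j * this
      · rw [divisibleReps_eq_empty hp h, chiDivisorSum_mul_of_not_dvd hp h]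
        simp
    rcases Nat.odd_mod_four_iff.1 (Nat.odd_iff.1 hpo) with h | h
    · have e := card_twoSquareReps_mul_add (n := k) hp h
      zify at e
      rw [ZMod.χ₄_nat_one_mod_four h] at hdiv
      linarith
    · rw [twoSquareReps_eq_divisibleReps hp h (dvd_mul_right p k), hdiv,
        ZMod.χ₄_nat_three_mod_four h]
      ring

/-- The quadruples `(b, l, k, c)` of positive integers with `b * l + k * c = m` and `b`, `c` odd. -/
def mixedQuads (m : ℕ) : Finset (ℕ × ℕ × ℕ × ℕ) :=
  {q ∈ range (m + 1) ×ˢ range (m + 1) ×ˢ range (m + 1) ×ˢ range (m + 1) |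
    q.1 * q.2.1 + q.2.2.1 * q.2.2.2 = m ∧ Odd q.1 ∧ 0 < q.2.1 ∧ 0 < q.2.2.1 ∧ Odd q.2.2.2}

lemma mem_mixedQuads {m b l k c : ℕ} :
    (b, l, k, c) ∈ mixedQuads m ↔ b * l + k * c = m ∧ Odd b ∧ 0 < l ∧ 0 < k ∧ Odd c := by
  simp only [mixedQuads, mem_filter, mem_product, mem_range, and_iff_right_iff_imp]
  rintro ⟨h, hb, hl, hk, hc⟩
  have := hb.pos
  have := hc.pos
  refine ⟨?_, ?_, ?_, ?_⟩ <;> nlinarith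

/-- The quadruples `(a, c, b, d)` of odd positive integers with `a * c + b * d = n`. -/
def oddQuads (n : ℕ) : Finset (ℕ × ℕ × ℕ × ℕ) :=
  {q ∈ range (n + 1) ×ˢ range (n + 1) ×ˢ range (n + 1) ×ˢ range (n + 1) |
    q.1 * q.2.1 + q.2.2.1 * q.2.2.2 = n ∧ Odd q.1 ∧ Odd q.2.1 ∧ Odd q.2.2.1 ∧ Odd q.2.2.2}

lemma mem_oddQuads {n a c b d : ℕ} :
    (a, c, b, d) ∈ oddQuads n ↔ a * c + b * d = n ∧ Odd a ∧ Odd c ∧ Odd b ∧ Odd d := by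
  simp only [oddQuads, mem_filter, mem_product, mem_range, and_iff_right_iff_imp]
  rintro ⟨h, ha, hc, hb, hd⟩
  have := ha.pos
  have := hb.pos
  have := hc.pos
  have := hd.pos
  refine ⟨?_, ?_, ?_, ?_⟩ <;> nlinarith

lemma neg_one_pow_eq_neg_of_mem_mixedQuads {m b l k c : ℕ} (hm : Odd m)
    (h : (b, l, k, c) ∈ mixedQuads m) : (-1 : ℤ) ^ k = -(-1) ^ l := by
  obtain ⟨h, hb, -, -, hc⟩ := mem_mixedQuads.1 h
  rw [← h, Nat.odd_add, Nat.odd_mul, Nat.even_mul] at hm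
  have hc' : ¬ Even c := Nat.not_even_iff_odd.2 hc
  rcases Nat.even_or_odd l with hl | hl
  · have : Odd k := by
      rw [← Nat.not_even_iff_odd] at hm ⊢
      have := Nat.not_odd_iff_even.2 hl
      tauto
    rw [hl.neg_one_pow, this.neg_one_pow]
  · have : Even k := by tauto
    rw [hl.neg_one_pow, this.neg_one_pow]; norm_num

/-- Exchanging the two products negates alternating sums over `mixedQuads`. -/
lemma sum_mixedQuads_swap {m : ℕ} (hm : Odd m) (P Q : ℕ × ℕ × ℕ × ℕ → Prop)
    [DecidablePred P] [DecidablePred Q] (hPQ : ∀ b l k c, P (b, l, k, c) ↔ Q (c, k, l, b)) :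
    ∑ q ∈ mixedQuads m with P q, (-1 : ℤ) ^ q.2.2.1 =
      -∑ q ∈ mixedQuads m with Q q, (-1 : ℤ) ^ q.2.2.1 := by
  rw [← sum_neg_distrib]
  have hmem : ∀ b l k c, (b, l, k, c) ∈ mixedQuads m ↔ (c, k, l, b) ∈ mixedQuads m := by
    intro b l k c
    rw [mem_mixedQuads, mem_mixedQuads, add_comm, mul_comm k, mul_comm b]
    tauto
  refine sum_nbij' (fun q => (q.2.2.2, q.2.2.1, q.2.1, q.1))
    (fun q => (q.2.2.2, q.2.2.1, q.2.1, q.1)) ?_ ?_ ?_ ?_ ?_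
  · rintro ⟨b, l, k, c⟩ h
    rw [mem_filter] at h ⊢
    exact ⟨(hmem _ _ _ _).1 h.1, (hPQ _ _ _ _).1 h.2⟩
  · rintro ⟨b, l, k, c⟩ h
    rw [mem_filter] at h ⊢
    exact ⟨(hmem _ _ _ _).1 h.1, (hPQ _ _ _ _).2 h.2⟩
  · intros; rfl
  · intros; rfl
  · rintro ⟨b, l, k, c⟩ h
    exact neg_one_pow_eq_neg_of_mem_mixedQuads hm (mem_filter.1 h).1

lemma sum_mixedQuads_shift (m : ℕ) :
    ∑ q ∈ mixedQuads m with 2 * q.2.2.1 < q.1, (-1 : ℤ) ^ q.2.2.1 =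
      ∑ q ∈ mixedQuads m with 2 * q.2.1 < q.2.2.2, (-1 : ℤ) ^ q.2.2.1 := by
  refine sum_nbij' (fun q => (q.1 - 2 * q.2.2.1, q.2.1, q.2.2.1, q.2.2.2 + 2 * q.2.1))
    (fun q => (q.1 + 2 * q.2.2.1, q.2.1, q.2.2.1, q.2.2.2 - 2 * q.2.1)) ?_ ?_ ?_ ?_ ?_
  · rintro ⟨b, l, k, c⟩ h
    simp only [mem_filter, mem_mixedQuads] at h ⊢
    obtain ⟨⟨h, hb, hl, hk, hc⟩, hlt⟩ := h
    obtain ⟨b, rfl⟩ := Nat.exists_eq_add_of_lt hlt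
    refine ⟨⟨?_, ?_, hl, hk, ?_⟩, ?_⟩
    · rw [show 2 * k + b + 1 - 2 * k = b + 1 by omega, ← h]; ring
    · grind
    · grind
    · have := hc.pos; omega
  · rintro ⟨b, l, k, c⟩ h
    simp only [mem_filter, mem_mixedQuads] at h ⊢
    obtain ⟨⟨h, hb, hl, hk, hc⟩, hlt⟩ := h
    obtain ⟨c, rfl⟩ := Nat.exists_eq_add_of_lt hlt
    refine ⟨⟨?_, ?_, hl, hk, ?_⟩, ?_⟩
    · rw [show 2 * l + c + 1 - 2 * l = c + 1 by omega, ← h]; ring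
    · grind
    · grind
    · have := hb.pos; omega
  · rintro ⟨b, l, k, c⟩ h
    have := (mem_filter.1 h).2
    simp only [Prod.mk.injEq, true_and] at this ⊢
    omega
  · rintro ⟨b, l, k, c⟩ h
    have := (mem_filter.1 h).2
    simp only [Prod.mk.injEq, true_and] at this ⊢
    omega
  · intros; rfl

lemma sum_mixedQuads_filter_lt {m : ℕ} (hm : Odd m) :
    ∑ q ∈ mixedQuads m with q.2.2.2 < 2 * q.2.1, (-1 : ℤ) ^ q.2.2.1 = 0 := by
  have h1 := sum_mixedQuads_swap hm (fun _ => True) (fun _ => True) (by simp)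
  have h2 := sum_mixedQuads_swap hm (fun q => 2 * q.2.2.1 < q.1) (fun q => 2 * q.2.1 < q.2.2.2)
    (by simp)
  rw [sum_mixedQuads_shift] at h2
  have h3 := sum_filter_add_sum_filter_not (mixedQuads m) (fun q => q.2.2.2 < 2 * q.2.1)
    (fun q => (-1 : ℤ) ^ q.2.2.1)
  have h4 : {q ∈ mixedQuads m | ¬ q.2.2.2 < 2 * q.2.1} =
      {q ∈ mixedQuads m | 2 * q.2.1 < q.2.2.2} := by
    refine filter_congr ?_
    rintro ⟨b, l, k, c⟩ h
    obtain ⟨-, -, -, -, c, rfl⟩ := mem_mixedQuads.1 h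
    simp only
    omega
  rw [h4] at h3
  simp only [filter_true] at h1
  linarith

lemma chi_add_two_mul_mul_chi {b k : ℕ} (hb : Odd b) :
    ZMod.χ₄ (b + 2 * k : ℕ) * ZMod.χ₄ b = (-1) ^ k := by
  obtain ⟨j, rfl⟩ := hb
  rw [ZMod.χ₄_eq_neg_one_pow (by omega), ZMod.χ₄_eq_neg_one_pow (by omega),
    show (2 * j + 1 + 2 * k) / 2 = j + k by omega, show (2 * j + 1) / 2 = j by omega, pow_add,
    mul_right_comm, ← mul_pow]
  simp

lemma sum_oddQuads_filter_gt {m : ℕ} (hm : Odd m) :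
    ∑ q ∈ oddQuads (2 * m) with q.2.2.1 < q.1, ZMod.χ₄ q.1 * ZMod.χ₄ q.2.2.1 = 0 := by
  rw [← sum_mixedQuads_filter_lt hm]
  symm
  refine sum_nbij' (fun q => (q.1 + 2 * q.2.2.1, q.2.2.2, q.1, 2 * q.2.1 - q.2.2.2))
    (fun q => (q.2.2.1, (q.2.1 + q.2.2.2) / 2, (q.1 - q.2.2.1) / 2, q.2.1)) ?_ ?_ ?_ ?_ ?_
  · rintro ⟨b, l, k, c⟩ h
    simp only [mem_filter, mem_mixedQuads, mem_oddQuads] at h ⊢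
    obtain ⟨⟨h, hb, hl, hk, hc⟩, hlt⟩ := h
    obtain ⟨d, hd⟩ := Nat.exists_eq_add_of_lt hlt
    refine ⟨⟨?_, ?_, hc, hb, ?_⟩, ?_⟩
    · rw [show 2 * l - c = d + 1 by omega, ← h]
      zify at hd ⊢
      linear_combination (-b : ℤ) * hd
    · grind
    · grind
    · omega
  · rintro ⟨a, c, b, d⟩ h
    simp only [mem_filter, mem_mixedQuads, mem_oddQuads] at h ⊢
    obtain ⟨⟨h, ⟨a, rfl⟩, ⟨c, rfl⟩, ⟨b, rfl⟩, d, rfl⟩, hlt⟩ := h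
    obtain ⟨k, rfl⟩ := Nat.exists_eq_add_of_lt (show b < a by omega)
    rw [show (2 * c + 1 + (2 * d + 1)) / 2 = c + d + 1 by omega,
      show (2 * (b + k + 1) + 1 - (2 * b + 1)) / 2 = k + 1 by omega]
    refine ⟨⟨?_, ⟨b, rfl⟩, by omega, by omega, c, rfl⟩, by omega⟩
    linarith
  · rintro ⟨b, l, k, c⟩ h
    have := (mem_filter.1 h).2
    simp only [Prod.mk.injEq, true_and, and_true] at this ⊢
    omega
  · rintro ⟨a, c, b, d⟩ h
    simp only [mem_filter, mem_oddQuads] at h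
    obtain ⟨⟨-, ⟨a, rfl⟩, ⟨c, rfl⟩, ⟨b, rfl⟩, d, rfl⟩, hlt⟩ := h
    simp only [Prod.mk.injEq, true_and]
    omega
  · rintro ⟨b, l, k, c⟩ h
    exact (chi_add_two_mul_mul_chi (mem_mixedQuads.1 (mem_filter.1 h).1).2.1).symm

lemma sum_oddQuads_filter_lt {m : ℕ} (hm : Odd m) :
    ∑ q ∈ oddQuads (2 * m) with q.1 < q.2.2.1, ZMod.χ₄ q.1 * ZMod.χ₄ q.2.2.1 = 0 := by
  rw [← sum_oddQuads_filter_gt hm]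
  have hmem : ∀ a c b d, (a, c, b, d) ∈ oddQuads (2 * m) → (b, d, a, c) ∈ oddQuads (2 * m) := by
    intro a c b d
    rw [mem_oddQuads, mem_oddQuads, add_comm]
    tauto
  refine sum_nbij' (fun q => (q.2.2.1, q.2.2.2, q.1, q.2.1))
    (fun q => (q.2.2.1, q.2.2.2, q.1, q.2.1)) ?_ ?_ ?_ ?_ ?_
  · rintro ⟨a, c, b, d⟩ h
    rw [mem_filter] at h ⊢
    exact ⟨hmem _ _ _ _ h.1, h.2⟩
  · rintro ⟨a, c, b, d⟩ h
    rw [mem_filter] at h ⊢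
    exact ⟨hmem _ _ _ _ h.1, h.2⟩
  · intros; rfl
  · intros; rfl
  · intros; exact mul_comm _ _

lemma sum_oddQuads_filter_eq {m : ℕ} (hm : Odd m) :
    ∑ q ∈ oddQuads (2 * m) with q.1 = q.2.2.1, ZMod.χ₄ q.1 * ZMod.χ₄ q.2.2.1 =
      ∑ d ∈ m.divisors, (d : ℤ) := by
  have e : ∑ d ∈ m.divisors, (d : ℤ) = ∑ _q ∈ m.divisors.sigma fun d => range (m / d), (1 : ℤ) := by
    rw [sum_sigma, ← Nat.sum_div_divisors m fun d => (d : ℤ)]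
    simp
  rw [e]
  symm
  refine sum_bij' (fun q _ => (q.1, 2 * q.2 + 1, q.1, 2 * (m / q.1) - (2 * q.2 + 1)))
    (fun q _ => ⟨q.1, q.2.1 / 2⟩) ?_ ?_ ?_ ?_ ?_
  · rintro ⟨d, i⟩ h
    simp only [mem_sigma, Nat.mem_divisors, mem_range, mem_filter, mem_oddQuads, and_true] at h ⊢
    obtain ⟨⟨hd, -⟩, hi⟩ := h
    have hdo := hm.of_dvd_nat hd
    refine ⟨?_, hdo, ⟨i, rfl⟩, hdo, m / d - i - 1, by omega⟩
    rw [← mul_add, Nat.add_sub_of_le (by omega), mul_left_comm, Nat.mul_div_cancel' hd]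
  · rintro ⟨a, c, b, d⟩ h
    simp only [mem_sigma, Nat.mem_divisors, mem_range, mem_filter, mem_oddQuads] at h ⊢
    obtain ⟨⟨h, ha, ⟨c, rfl⟩, -, d, rfl⟩, rfl⟩ := h
    have e : m = a * (c + d + 1) := by linarith
    refine ⟨⟨⟨_, e⟩, hm.pos.ne'⟩, ?_⟩
    rw [e, Nat.mul_div_cancel_left _ ha.pos]
    omega
  · rintro ⟨d, i⟩ h
    simp only [Sigma.mk.injEq, heq_eq_eq, true_and]
    omega
  · rintro ⟨a, c, b, d⟩ h
    simp only [mem_filter, mem_oddQuads] at h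
    obtain ⟨⟨h, ha, ⟨c, rfl⟩, -, d, rfl⟩, rfl⟩ := h
    have e : m = a * (c + d + 1) := by linarith
    simp only [Prod.mk.injEq, true_and]
    rw [e, Nat.mul_div_cancel_left _ ha.pos]
    omega
  · rintro ⟨d, i⟩ h
    rw [mem_sigma] at h
    have := chi_add_two_mul_mul_chi (k := 0) (hm.of_dvd_nat (Nat.dvd_of_mem_divisors h.1))
    simpa using this.symm

/-- Dirichlet's evaluation of the sum of `χ₄ a * χ₄ b` over `a * c + b * d = 2 * m`. -/
lemma sum_oddQuads {m : ℕ} (hm : Odd m) :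
    ∑ q ∈ oddQuads (2 * m), ZMod.χ₄ q.1 * ZMod.χ₄ q.2.2.1 = ∑ d ∈ m.divisors, (d : ℤ) := by
  rw [← sum_filter_add_sum_filter_not _ (fun q : ℕ × ℕ × ℕ × ℕ => q.1 = q.2.2.1),
    sum_oddQuads_filter_eq hm,
    ← sum_filter_add_sum_filter_not (filter _ _) (fun q : ℕ × ℕ × ℕ × ℕ => q.1 < q.2.2.1),
    filter_filter, filter_filter]
  have h1 : {q ∈ oddQuads (2 * m) | ¬ q.1 = q.2.2.1 ∧ q.1 < q.2.2.1} =
      {q ∈ oddQuads (2 * m) | q.1 < q.2.2.1} := filter_congr fun q _ => by omega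
  have h2 : {q ∈ oddQuads (2 * m) | ¬ q.1 = q.2.2.1 ∧ ¬ q.1 < q.2.2.1} =
      {q ∈ oddQuads (2 * m) | q.2.2.1 < q.1} := filter_congr fun q _ => by omega
  rw [h1, h2, sum_oddQuads_filter_lt hm, sum_oddQuads_filter_gt hm]
  simp

/-- The pairs of odd positive integers with sum `2 * m`. -/
def oddPairs (m : ℕ) : Finset (ℕ × ℕ) :=
  {u ∈ antidiagonal (2 * m) | Odd u.1}

lemma mem_oddPairs {m : ℕ} {u : ℕ × ℕ} :
    u ∈ oddPairs m ↔ u.1 + u.2 = 2 * m ∧ Odd u.1 ∧ Odd u.2 := by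
  rw [oddPairs, mem_filter, HasAntidiagonal.mem_antidiagonal]
  grind

lemma sum_chiDivisorSum_mul {m : ℕ} (hm : Odd m) :
    ∑ u ∈ oddPairs m, chiDivisorSum u.1 * chiDivisorSum u.2 = ∑ d ∈ m.divisors, (d : ℤ) := by
  rw [← sum_oddQuads hm]
  have e : ∀ u ∈ oddPairs m, chiDivisorSum u.1 * chiDivisorSum u.2 =
      ∑ d ∈ u.1.divisors ×ˢ u.2.divisors, ZMod.χ₄ d.1 * ZMod.χ₄ d.2 := fun u _ => by
    rw [chiDivisorSum, chiDivisorSum, sum_mul_sum, sum_product]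
  rw [sum_congr rfl e, sum_sigma']
  refine sum_bij' (fun q _ => (q.2.1, q.1.1 / q.2.1, q.2.2, q.1.2 / q.2.2))
    (fun q _ => ⟨(q.1 * q.2.1, q.2.2.1 * q.2.2.2), q.1, q.2.2.1⟩) ?_ ?_ ?_ ?_ ?_
  · rintro ⟨⟨u, v⟩, a, b⟩ h
    simp only [mem_sigma, mem_oddPairs, mem_product, Nat.mem_divisors, mem_oddQuads] at h ⊢
    obtain ⟨⟨h, hu, hv⟩, ⟨⟨c, rfl⟩, -⟩, ⟨d, rfl⟩, -⟩ := h
    rw [Nat.odd_mul] at hu hv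
    rw [Nat.mul_div_cancel_left _ hu.1.pos, Nat.mul_div_cancel_left _ hv.1.pos]
    exact ⟨h, hu.1, hu.2, hv.1, hv.2⟩
  · rintro ⟨a, c, b, d⟩ h
    simp only [mem_sigma, mem_oddPairs, mem_product, Nat.mem_divisors, mem_oddQuads] at h ⊢
    obtain ⟨h, ha, hc, hb, hd⟩ := h
    exact ⟨⟨h, ha.mul hc, hb.mul hd⟩, ⟨dvd_mul_right _ _, (ha.mul hc).pos.ne'⟩,
      dvd_mul_right _ _, (hb.mul hd).pos.ne'⟩
  · rintro ⟨⟨u, v⟩, a, b⟩ h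
    simp only [mem_sigma, mem_product, Nat.mem_divisors] at h
    simp [Nat.mul_div_cancel' h.2.1.1, Nat.mul_div_cancel' h.2.2.1]
  · rintro ⟨a, c, b, d⟩ h
    obtain ⟨-, ha, -, hb, -⟩ := mem_oddQuads.1 h
    simp [ha.pos, hb.pos]
  · intros; rfl

/-- The solutions of `x² + y² = n` with `x` odd. -/
noncomputable def oddFirstReps (n : ℕ) : Finset (ℤ × ℤ) :=
  {v ∈ twoSquareReps n | Odd v.1}

lemma card_oddFirstReps {n : ℕ} (hn : Odd n) :
    (#(oddFirstReps n) : ℤ) = 2 * chiDivisorSum n := by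
  have h := card_filter_add_card_filter_not (s := twoSquareReps n) (fun v => Odd v.1)
  have hs : #{v ∈ twoSquareReps n | ¬ Odd v.1} = #(oddFirstReps n) := by
    have par : ∀ x y : ℤ, x ^ 2 + y ^ 2 = n → (Odd x ↔ ¬ Odd y) := fun x y hxy => by
      have : Odd (x ^ 2 + y ^ 2) := by rw [hxy]; exact_mod_cast hn
      simp only [Int.odd_add, Int.odd_pow, Int.even_pow] at this
      rw [← Int.not_even_iff_odd] at *
      simp_all
    refine card_nbij' Prod.swap Prod.swap ?_ ?_ ?_ ?_
    · intro v hv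
      simp only [oddFirstReps, coe_filter, Set.mem_ofPred_eq, mem_twoSquareReps, Prod.fst_swap,
        Prod.snd_swap] at hv ⊢
      have := par _ _ hv.1
      exact ⟨by linarith, by tauto⟩
    · intro v hv
      simp only [oddFirstReps, coe_filter, Set.mem_ofPred_eq, mem_twoSquareReps, Prod.fst_swap,
        Prod.snd_swap] at hv ⊢
      have := par _ _ hv.1
      exact ⟨by linarith, by tauto⟩
    · exact fun _ _ => rfl
    · exact fun _ _ => rfl
  have := card_twoSquareReps hn
  rw [hs] at h
  rw [← h] at this
  rw [oddFirstReps] at *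
  push_cast at this
  linarith

/-- The solutions of `z² + c² + w² + d² = 2 * m` with `z`, `w` odd and `c`, `d` even, as
quadruples `((z, c), (w, d))`. -/
noncomputable def foldedReps (m : ℕ) : Finset ((ℤ × ℤ) × ℤ × ℤ) :=
  (oddPairs m).biUnion fun u => oddFirstReps u.1 ×ˢ oddFirstReps u.2

lemma mem_foldedReps {m : ℕ} {z c w d : ℤ} :
    ((z, c), (w, d)) ∈ foldedReps m ↔
      z ^ 2 + c ^ 2 + (w ^ 2 + d ^ 2) = 2 * m ∧ Odd z ∧ Even c ∧ Odd w ∧ Even d := by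
  simp only [foldedReps, oddFirstReps, mem_biUnion, mem_oddPairs, mem_product, mem_filter,
    mem_twoSquareReps]
  have par : ∀ x y : ℤ, Odd x → (Odd (x ^ 2 + y ^ 2) ↔ Even y) := fun x y hx => by
    simp [Int.odd_add, Int.odd_pow, Int.even_pow, hx]
  constructor
  · rintro ⟨u, ⟨h, hu, hv⟩, ⟨h1, hz⟩, h2, hw⟩
    refine ⟨by rw [h1, h2]; exact_mod_cast h, hz, (par _ _ hz).1 ?_, hw, (par _ _ hw).1 ?_⟩
    · rw [h1]; exact_mod_cast hu
    · rw [h2]; exact_mod_cast hv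
  · rintro ⟨h, hz, hc, hw, hd⟩
    have hu := (par _ _ hz).2 hc
    have hv := (par _ _ hw).2 hd
    obtain ⟨u, hu'⟩ := Int.eq_ofNat_of_zero_le (show 0 ≤ z ^ 2 + c ^ 2 by positivity)
    obtain ⟨v, hv'⟩ := Int.eq_ofNat_of_zero_le (show 0 ≤ w ^ 2 + d ^ 2 by positivity)
    rw [hu'] at h hu
    rw [hv'] at h hv
    exact ⟨(u, v), ⟨by exact_mod_cast h, by exact_mod_cast hu, by exact_mod_cast hv⟩,
      ⟨hu', hz⟩, hv', hw⟩

lemma card_foldedReps {m : ℕ} (hm : Odd m) : #(foldedReps m) = 4 * ∑ d ∈ m.divisors, d := by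
  have hd : (oddPairs m : Set (ℕ × ℕ)).PairwiseDisjoint
      fun u => oddFirstReps u.1 ×ˢ oddFirstReps u.2 := by
    intro u _ v _ huv
    rw [Function.onFun, Finset.disjoint_left]
    intro x hx hx'
    simp only [oddFirstReps, mem_product, mem_filter, mem_twoSquareReps] at hx hx'
    refine huv (Prod.ext ?_ ?_)
    · exact_mod_cast hx.1.1.symm.trans hx'.1.1
    · exact_mod_cast hx.2.1.symm.trans hx'.2.1
  zify
  rw [foldedReps, card_biUnion hd, ← sum_chiDivisorSum_mul hm, mul_sum]
  push_cast
  refine sum_congr rfl fun u hu => ?_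
  obtain ⟨-, h1, h2⟩ := mem_oddPairs.1 hu
  rw [card_product, Nat.cast_mul, card_oddFirstReps h1, card_oddFirstReps h2]
  ring

lemma folded_mem_foldedReps {m : ℕ} (hm : Odd m) {x y z w : ℤ}
    (h : x ^ 2 + y ^ 2 + 2 * z ^ 2 + 2 * w ^ 2 = 4 * m) (hx : Even x) (hy : Even y) (hz : Odd z)
    (hw : Odd w) : ((z, (x + y) / 2), (w, (x - y) / 2)) ∈ foldedReps m := by
  obtain ⟨a, rfl⟩ := hx
  obtain ⟨b, rfl⟩ := hy
  rw [mem_foldedReps, show (a + a + (b + b)) / 2 = a + b by omega,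
    show (a + a - (b + b)) / 2 = a - b by omega]
  have hab : Even (a + b) := by
    obtain ⟨z, rfl⟩ := hz
    obtain ⟨w, rfl⟩ := hw
    obtain ⟨k, rfl⟩ := hm
    push_cast at h
    have : Even (a ^ 2 + b ^ 2) := ⟨k - z ^ 2 - z - w ^ 2 - w, by linarith⟩
    simpa [Int.even_add, Int.even_pow] using this
  refine ⟨by linarith, hz, hab, hw, ?_⟩
  rwa [Int.even_sub, ← Int.even_add]

/-- `x² + y² + 2z² + 2w² = 4m` becomes `z² + c² + w² + d² = 2m` under `x = c + d`, `y = c - d`. -/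
def foldedRepsEquiv (m : ℕ) (hm : Odd m) :
    {v : ℤ × ℤ × ℤ × ℤ //
        v.1 ^ 2 + v.2.1 ^ 2 + 2 * v.2.2.1 ^ 2 + 2 * v.2.2.2 ^ 2 = (4 * m : ℤ) ∧
        Even v.1 ∧ Even v.2.1 ∧ Odd v.2.2.1 ∧ Odd v.2.2.2} ≃ {v // v ∈ foldedReps m} where
  toFun v := ⟨((v.1.2.2.1, (v.1.1 + v.1.2.1) / 2), (v.1.2.2.2, (v.1.1 - v.1.2.1) / 2)),
    folded_mem_foldedReps hm v.2.1 v.2.2.1 v.2.2.2.1 v.2.2.2.2.1 v.2.2.2.2.2⟩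
  invFun v := ⟨(v.1.1.2 + v.1.2.2, v.1.1.2 - v.1.2.2, v.1.1.1, v.1.2.1), by
    obtain ⟨⟨⟨z, c⟩, w, d⟩, h⟩ := v
    obtain ⟨h, hz, hc, hw, hd⟩ := mem_foldedReps.1 h
    exact ⟨by linarith, hc.add hd, hc.sub hd, hz, hw⟩⟩
  left_inv := by
    rintro ⟨⟨x, y, z, w⟩, h, ⟨a, ha⟩, ⟨b, hb⟩, hz, hw⟩
    simp only [Subtype.mk.injEq, Prod.mk.injEq, and_true] at ha hb ⊢
    omega
  right_inv := by
    rintro ⟨⟨⟨z, c⟩, w, d⟩, h⟩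
    simp only [Subtype.mk.injEq, Prod.mk.injEq, true_and]
    omega



/-- For `m` odd and positive, the number of representations of `4m` by
`x² + y² + 2z² + 2w²` with `x, y` even and `z, w` odd is `4σ(m)`. -/
theorem representation_count_four_m_even_even_odd_odd (m : ℕ) (hm : Odd m) (hpos : 0 < m) :
    Nat.card {v : ℤ × ℤ × ℤ × ℤ //
        v.1 ^ 2 + v.2.1 ^ 2 + 2 * v.2.2.1 ^ 2 + 2 * v.2.2.2 ^ 2 = (4 * m : ℤ) ∧
        Even v.1 ∧ Even v.2.1 ∧ Odd v.2.2.1 ∧ Odd v.2.2.2} =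
      4 * ∑ d ∈ m.divisors, d := by
  rw [Nat.card_congr (foldedRepsEquiv m hm), Nat.card_eq_fintype_card, Fintype.card_coe,
    card_foldedReps hm]
end

section
/- Let m be an odd positive integer. The number of quadruples (x, y, z, w) ∈ ℤ⁴ with x² + y² + 2z² + 2w² = 8m such that x and y are even and z and w are odd equals 16σ(m). -/
namespace FourOddSquares

open Finset

/-- Triples `(a, k, d)` with `a, d > 0` and `k² + k + a d = M`, encoding the binary quadratic forms
`a X² + (2k+1) X Y - d Y²` of discriminant `4M + 1`. -/
noncomputable def indefiniteForms (R M : ℤ) : Finset (ℤ × ℤ × ℤ) :=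
  {v ∈ Icc (-R) R ×ˢ Icc 1 R ×ˢ Icc 1 R | v.1 ^ 2 + v.1 + v.2.1 * v.2.2 = M}

/-- Quadruples `(p, q, r, s)` with `(2p+1)² + (2q+1)² + (2r+1)² + (2s+1)² = 4m`. -/
noncomputable def oddQuadruples (R m : ℤ) : Finset (ℤ × ℤ × ℤ × ℤ) :=
  {v ∈ Icc (-R) R ×ˢ Icc (-R) R ×ˢ Icc (-R) R ×ˢ Icc (-R) R |
    v.1 ^ 2 + v.1 + (v.2.1 ^ 2 + v.2.1) + (v.2.2.1 ^ 2 + v.2.2.1)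
      + (v.2.2.2 ^ 2 + v.2.2.2) + 1 = m}

/-- Quintuples of odd squares with sum `4M + 1`, each root written as `2k+1`. -/
noncomputable def oddQuintuples (R M : ℤ) : Finset (ℤ × ℤ × ℤ × ℤ × ℤ) :=
  {v ∈ Icc (-R) R ×ˢ Icc (-R) R ×ˢ Icc (-R) R ×ˢ Icc (-R) R ×ˢ Icc (-R) R |
    v.1 ^ 2 + v.1 + (v.2.1 ^ 2 + v.2.1) + (v.2.2.1 ^ 2 + v.2.2.1)
      + (v.2.2.2.1 ^ 2 + v.2.2.2.1) + (v.2.2.2.2 ^ 2 + v.2.2.2.2) + 1 = M}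

/-- Pairs of positive integers with product `m`. -/
noncomputable def factorPairs (R m : ℤ) : Finset (ℤ × ℤ) :=
  {v ∈ Icc 1 R ×ˢ Icc 1 R | v.1 * v.2 = m}

lemma sq_add_self_nonneg (k : ℤ) : 0 ≤ k ^ 2 + k := by
  rcases le_or_gt 0 k with h | h <;> nlinarith

lemma mem_Icc_of_sq_add_self_lt {R k : ℤ} (h : k ^ 2 + k < R) : k ∈ Icc (-R) R := by
  rw [mem_Icc]
  constructor <;> nlinarith [sq_nonneg (k + 1), sq_nonneg k]

lemma mem_indefiniteForms {R M : ℤ} (hM : M ≤ R) (a k d : ℤ) :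
    (k, a, d) ∈ indefiniteForms R M ↔ 0 < a ∧ 0 < d ∧ k ^ 2 + k + a * d = M := by
  simp only [indefiniteForms, mem_filter, mem_product]
  constructor
  · rintro ⟨⟨-, h1, h2⟩, h⟩
    rw [mem_Icc] at h1 h2
    exact ⟨by lia, by lia, h⟩
  · rintro ⟨ha, hd, h⟩
    have := sq_add_self_nonneg k
    refine ⟨⟨mem_Icc_of_sq_add_self_lt (by nlinarith), ?_, ?_⟩, h⟩ <;> rw [mem_Icc] <;>
      constructor <;> nlinarith

lemma mem_oddQuadruples {R m : ℤ} (hm : m ≤ R) (p q r s : ℤ) :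
    (p, q, r, s) ∈ oddQuadruples R m ↔
      p ^ 2 + p + (q ^ 2 + q) + (r ^ 2 + r) + (s ^ 2 + s) + 1 = m := by
  simp only [oddQuadruples, mem_filter, mem_product, and_iff_right_iff_imp]
  intro h
  have hp := sq_add_self_nonneg p
  have hq := sq_add_self_nonneg q
  have hr := sq_add_self_nonneg r
  have hs := sq_add_self_nonneg s
  refine ⟨?_, ?_, ?_, ?_⟩ <;> apply mem_Icc_of_sq_add_self_lt <;> lia

lemma mem_factorPairs {R m : ℤ} (hm : m ≤ R) (a d : ℤ) :
    (a, d) ∈ factorPairs R m ↔ 0 < a ∧ 0 < d ∧ a * d = m := by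
  simp only [factorPairs, mem_filter, mem_product, mem_Icc]
  constructor
  · rintro ⟨⟨h1, h2⟩, h⟩
    exact ⟨by lia, by lia, h⟩
  · rintro ⟨ha, hd, h⟩
    refine ⟨⟨⟨ha, ?_⟩, hd, ?_⟩, h⟩ <;> nlinarith

lemma odd_mul_of_mem {k a d M : ℤ} (hM : Odd M) (h : k ^ 2 + k + a * d = M) :
    Odd a ∧ Odd d := by
  rw [← Int.odd_mul]
  have he : Even (k ^ 2 + k) := by
    have := Int.even_mul_succ_self k
    convert this using 1; ring
  have : a * d = M - (k ^ 2 + k) := by linarith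
  rw [this]
  exact hM.sub_even he

/-- Splitting a sum over forms by the sign of `a + b - d`, and folding the negative part back
by the symmetry `(a, b, d) ↦ (d, -b, a)`. -/
lemma sum_indefiniteForms_fold {R M : ℤ} (hM : M ≤ R) (hodd : Odd M) (f : ℤ × ℤ × ℤ → ℤ) :
    ∑ v ∈ indefiniteForms R M, f v =
      ∑ v ∈ indefiniteForms R M with 0 < v.2.1 + (2 * v.1 + 1) - v.2.2,
        (f v + f (-1 - v.1, v.2.2, v.2.1)) := by
  rw [sum_add_distrib,
    ← sum_filter_add_sum_filter_not _ (fun v : ℤ × ℤ × ℤ => 0 < v.2.1 + (2 * v.1 + 1) - v.2.2)]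
  congr 1
  refine sum_nbij' (fun v => (-1 - v.1, v.2.2, v.2.1)) (fun v => (-1 - v.1, v.2.2, v.2.1))
    ?_ ?_ ?_ ?_ ?_
  · rintro ⟨k, a, d⟩ h
    simp only [mem_filter, mem_indefiniteForms hM] at h ⊢
    obtain ⟨⟨ha, hd, h⟩, hs⟩ := h
    obtain ⟨h1, h2⟩ := odd_mul_of_mem hodd h
    refine ⟨⟨hd, ha, by linarith⟩, ?_⟩
    obtain ⟨x, rfl⟩ := h1
    obtain ⟨y, rfl⟩ := h2
    lia
  · rintro ⟨k, a, d⟩ h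
    simp only [mem_filter, mem_indefiniteForms hM] at h ⊢
    obtain ⟨⟨ha, hd, h⟩, hs⟩ := h
    exact ⟨⟨hd, ha, by linarith⟩, by lia⟩
  all_goals
    rintro ⟨k, a, d⟩ -
    simp

lemma sum_sq_mul_middle_eq_zero {R M : ℤ} (hM : M ≤ R) :
    ∑ v ∈ indefiniteForms R M, v.2.1 ^ 2 * (2 * v.1 + 1) = 0 := by
  have h : ∑ v ∈ indefiniteForms R M, v.2.1 ^ 2 * (2 * v.1 + 1) =
      ∑ v ∈ indefiniteForms R M, -(v.2.1 ^ 2 * (2 * v.1 + 1)) := by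
    refine sum_nbij' (fun v => (-1 - v.1, v.2)) (fun v => (-1 - v.1, v.2)) ?_ ?_ ?_ ?_ ?_
    iterate 2
      rintro ⟨k, a, d⟩ h
      simp only [mem_indefiniteForms hM] at h ⊢
      exact ⟨h.1, h.2.1, by linarith⟩
    iterate 2
      rintro ⟨k, a, d⟩ -
      simp
    rintro ⟨k, a, d⟩ -
    ring
  rw [sum_neg_distrib] at h
  lia

/-- The involution `(a, b, d) ↦ (a + b - d, 2 d - b, d)` on forms with `a + b - d > 0` changes the
sign of this summand. -/
lemma sum_pos_part_eq_zero {R M : ℤ} (hM : M ≤ R) :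
    ∑ v ∈ indefiniteForms R M with 0 < v.2.1 + (2 * v.1 + 1) - v.2.2,
      ((v.2.1 + v.2.2) * (v.2.1 * v.2.2 - (2 * v.1 + 1) ^ 2)
        - (v.2.1 ^ 2 - v.2.2 ^ 2) * (2 * v.1 + 1)) = 0 := by
  set F : ℤ × ℤ × ℤ → ℤ := fun v => (v.2.1 + v.2.2) * (v.2.1 * v.2.2 - (2 * v.1 + 1) ^ 2)
        - (v.2.1 ^ 2 - v.2.2 ^ 2) * (2 * v.1 + 1) with hF
  have h : ∑ v ∈ indefiniteForms R M with 0 < v.2.1 + (2 * v.1 + 1) - v.2.2, F v =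
      ∑ v ∈ indefiniteForms R M with 0 < v.2.1 + (2 * v.1 + 1) - v.2.2, -F v := by
    refine sum_nbij' (fun v => (v.2.2 - 1 - v.1, v.2.1 + (2 * v.1 + 1) - v.2.2, v.2.2))
      (fun v => (v.2.2 - 1 - v.1, v.2.1 + (2 * v.1 + 1) - v.2.2, v.2.2)) ?_ ?_ ?_ ?_ ?_
    iterate 2
      rintro ⟨k, a, d⟩ h
      simp only [mem_filter, mem_indefiniteForms hM] at h ⊢
      obtain ⟨⟨ha, hd, h⟩, hs⟩ := h
      exact ⟨⟨hs, hd, by linarith⟩, by lia⟩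
    iterate 2
      rintro ⟨k, a, d⟩ -
      simp only [Prod.mk.injEq]
      lia
    rintro ⟨k, a, d⟩ -
    simp only [hF]
    ring
  rw [sum_neg_distrib] at h
  lia

lemma sum_indefiniteForms_eq_zero {R M : ℤ} (hM : M ≤ R) (hodd : Odd M) :
    ∑ v ∈ indefiniteForms R M, (4 * M + 1 - 5 * (2 * v.1 + 1) ^ 2) * v.2.1 = 0 := by
  have h : ∑ v ∈ indefiniteForms R M, (4 * M + 1 - 5 * (2 * v.1 + 1) ^ 2) * v.2.1 =
      4 * ∑ v ∈ indefiniteForms R M, v.2.1 * (v.2.1 * v.2.2 - (2 * v.1 + 1) ^ 2) := by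
    rw [mul_sum]
    refine sum_congr rfl ?_
    rintro ⟨k, a, d⟩ h
    obtain ⟨-, -, rfl⟩ := (mem_indefiniteForms hM a k d).1 h
    ring
  have h1 := sum_pos_part_eq_zero hM
  have h2 := sum_sq_mul_middle_eq_zero hM
  rw [sum_indefiniteForms_fold hM hodd] at h2
  rw [sum_sub_distrib] at h1
  rw [h, sum_indefiniteForms_fold hM hodd]
  have e1 : ∀ v : ℤ × ℤ × ℤ, v.2.1 ^ 2 * (2 * v.1 + 1) + v.2.2 ^ 2 * (2 * (-1 - v.1) + 1) =
      (v.2.1 ^ 2 - v.2.2 ^ 2) * (2 * v.1 + 1) := fun v => by ring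
  have e2 : ∀ v : ℤ × ℤ × ℤ, v.2.1 * (v.2.1 * v.2.2 - (2 * v.1 + 1) ^ 2)
      + v.2.2 * (v.2.2 * v.2.1 - (2 * (-1 - v.1) + 1) ^ 2) =
      (v.2.1 + v.2.2) * (v.2.1 * v.2.2 - (2 * v.1 + 1) ^ 2) := fun v => by ring
  simp only [e1, e2] at h2 ⊢
  lia

lemma sum_factorPairs_recurrence {R M : ℤ} (hM : M ≤ R) (hodd : Odd M) :
    ∑ k ∈ Icc (-R) R, (4 * M + 1 - 5 * (2 * k + 1) ^ 2) *
      ∑ v ∈ factorPairs R (M - (k ^ 2 + k)), v.1 = 0 := by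
  rw [← sum_indefiniteForms_eq_zero hM hodd, indefiniteForms, sum_filter, sum_product]
  refine sum_congr rfl fun k _ => ?_
  rw [factorPairs, mul_sum, sum_filter]
  refine sum_congr rfl fun v _ => if_congr ?_ rfl rfl
  constructor <;> intro h <;> linarith

lemma sum_oddQuintuples_eq_zero (R M : ℤ) :
    ∑ v ∈ oddQuintuples R M, (4 * M + 1 - 5 * (2 * v.1 + 1) ^ 2) = 0 := by
  have h2 : ∑ v ∈ oddQuintuples R M, (2 * v.1 + 1) ^ 2 =
      ∑ v ∈ oddQuintuples R M, (2 * v.2.1 + 1) ^ 2 := by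
    refine sum_nbij' (fun v => (v.2.1, v.1, v.2.2)) (fun v => (v.2.1, v.1, v.2.2))
      ?_ ?_ ?_ ?_ ?_ <;> rintro ⟨p, q, r, s, t⟩ h <;>
      simp only [oddQuintuples, mem_filter, mem_product] at h ⊢ <;> grind
  have h3 : ∑ v ∈ oddQuintuples R M, (2 * v.1 + 1) ^ 2 =
      ∑ v ∈ oddQuintuples R M, (2 * v.2.2.1 + 1) ^ 2 := by
    refine sum_nbij' (fun v => (v.2.2.1, v.2.1, v.1, v.2.2.2))
      (fun v => (v.2.2.1, v.2.1, v.1, v.2.2.2))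
      ?_ ?_ ?_ ?_ ?_ <;> rintro ⟨p, q, r, s, t⟩ h <;>
      simp only [oddQuintuples, mem_filter, mem_product] at h ⊢ <;> grind
  have h4 : ∑ v ∈ oddQuintuples R M, (2 * v.1 + 1) ^ 2 =
      ∑ v ∈ oddQuintuples R M, (2 * v.2.2.2.1 + 1) ^ 2 := by
    refine sum_nbij' (fun v => (v.2.2.2.1, v.2.1, v.2.2.1, v.1, v.2.2.2.2))
      (fun v => (v.2.2.2.1, v.2.1, v.2.2.1, v.1, v.2.2.2.2))
      ?_ ?_ ?_ ?_ ?_ <;> rintro ⟨p, q, r, s, t⟩ h <;>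
      simp only [oddQuintuples, mem_filter, mem_product] at h ⊢ <;> grind
  have h5 : ∑ v ∈ oddQuintuples R M, (2 * v.1 + 1) ^ 2 =
      ∑ v ∈ oddQuintuples R M, (2 * v.2.2.2.2 + 1) ^ 2 := by
    refine sum_nbij' (fun v => (v.2.2.2.2, v.2.1, v.2.2.1, v.2.2.2.1, v.1))
      (fun v => (v.2.2.2.2, v.2.1, v.2.2.1, v.2.2.2.1, v.1))
      ?_ ?_ ?_ ?_ ?_ <;> rintro ⟨p, q, r, s, t⟩ h <;>
      simp only [oddQuintuples, mem_filter, mem_product] at h ⊢ <;> grind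
  have hsum : ∑ v ∈ oddQuintuples R M, (4 * M + 1) = ∑ v ∈ oddQuintuples R M,
      ((2 * v.1 + 1) ^ 2 + (2 * v.2.1 + 1) ^ 2 + (2 * v.2.2.1 + 1) ^ 2
        + (2 * v.2.2.2.1 + 1) ^ 2 + (2 * v.2.2.2.2 + 1) ^ 2) := by
    refine sum_congr rfl fun v hv => ?_
    rw [← (mem_filter.1 hv).2]
    ring
  simp only [sum_add_distrib] at hsum
  rw [sum_sub_distrib, ← mul_sum, sum_add_distrib]
  lia

lemma card_oddQuadruples_recurrence (R M : ℤ) :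
    ∑ k ∈ Icc (-R) R, (4 * M + 1 - 5 * (2 * k + 1) ^ 2) *
      (#(oddQuadruples R (M - (k ^ 2 + k))) : ℤ) = 0 := by
  rw [← sum_oddQuintuples_eq_zero R M, oddQuintuples, sum_filter, sum_product]
  refine sum_congr rfl fun k _ => ?_
  rw [oddQuadruples, card_eq_sum_ones, Nat.cast_sum, mul_sum, sum_filter]
  refine sum_congr rfl fun v _ => if_congr ?_ (by simp) rfl
  constructor <;> intro h <;> linarith

lemma oddQuadruples_eq_empty {R m : ℤ} (hm : m ≤ 0) : oddQuadruples R m = ∅ := by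
  refine filter_eq_empty_iff.2 fun v _ h => ?_
  have hp := sq_add_self_nonneg v.1
  have hq := sq_add_self_nonneg v.2.1
  have hr := sq_add_self_nonneg v.2.2.1
  have hs := sq_add_self_nonneg v.2.2.2
  lia

lemma factorPairs_eq_empty {R m : ℤ} (hm : m ≤ 0) : factorPairs R m = ∅ := by
  refine filter_eq_empty_iff.2 fun v hv h => ?_
  simp only [mem_product, mem_Icc] at hv
  nlinarith

lemma oddQuadruples_one {R : ℤ} (hR : 1 ≤ R) :
    oddQuadruples R 1 =
      ({-1, 0} : Finset ℤ) ×ˢ ({-1, 0} : Finset ℤ) ×ˢ ({-1, 0} : Finset ℤ) ×ˢ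
        ({-1, 0} : Finset ℤ) := by
  have key : ∀ k : ℤ, k ^ 2 + k = 0 ↔ k = -1 ∨ k = 0 := fun k => by
    rw [show k ^ 2 + k = (k + 1) * k by ring, mul_eq_zero, add_eq_zero_iff_eq_neg]
  ext ⟨p, q, r, s⟩
  rw [mem_oddQuadruples hR]
  simp only [mem_product, mem_insert, mem_singleton, ← key]
  have hp := sq_add_self_nonneg p
  have hq := sq_add_self_nonneg q
  have hr := sq_add_self_nonneg r
  have hs := sq_add_self_nonneg s
  lia

lemma factorPairs_one {R : ℤ} (hR : 1 ≤ R) : factorPairs R 1 = {(1, 1)} := by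
  ext ⟨a, d⟩
  rw [mem_factorPairs hR, mem_singleton, Prod.mk.injEq]
  constructor
  · rintro ⟨ha, hd, h⟩
    exact ⟨by nlinarith, by nlinarith⟩
  · rintro ⟨rfl, rfl⟩
    simp

/-- Jacobi's theorem on sums of four odd squares. -/
theorem card_oddQuadruples {R : ℤ} (n : ℕ) (hn : (n : ℤ) ≤ R) (hodd : Odd n) :
    (#(oddQuadruples R n) : ℤ) = 16 * ∑ v ∈ factorPairs R n, v.1 := by
  induction n using Nat.strong_induction_on with
  | _ n ih =>
    rcases eq_or_ne n 1 with rfl | hn1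
    · rw [Nat.cast_one] at hn ⊢
      rw [oddQuadruples_one hn, factorPairs_one hn]
      simp
    have hodd' : Odd (n : ℤ) := by exact_mod_cast hodd
    have hpos : 0 < n := hodd.pos
    set D : ℤ → ℤ := fun m => (#(oddQuadruples R m) : ℤ) - 16 * ∑ v ∈ factorPairs R m, v.1 with hD
    have hrec : ∑ k ∈ Icc (-R) R, (4 * (n : ℤ) + 1 - 5 * (2 * k + 1) ^ 2) *
        D (n - (k ^ 2 + k)) = 0 := by
      have h1 := card_oddQuadruples_recurrence R n
      have h2 := sum_factorPairs_recurrence hn hodd'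
      simp only [hD, mul_sub, sum_sub_distrib, mul_left_comm _ (16 : ℤ), ← mul_sum]
      lia
    have hzero : ∀ k : ℤ, k ≠ -1 → k ≠ 0 → D (n - (k ^ 2 + k)) = 0 := by
      intro k hk1 hk0
      have hk : 0 < k ^ 2 + k := by
        rcases lt_or_gt_of_ne hk0 with h | h
        · have : k < -1 := by lia
          nlinarith
        · nlinarith
      rcases le_or_gt ((n : ℤ) - (k ^ 2 + k)) 0 with hle | hgt
      · simp [hD, oddQuadruples_eq_empty hle, factorPairs_eq_empty hle]
      · obtain ⟨j, hj⟩ := Int.eq_ofNat_of_zero_le hgt.le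
        have he : Even (k ^ 2 + k) := by
          have := Int.even_mul_succ_self k
          convert this using 1; ring
        have hjodd : Odd (j : ℤ) := hj ▸ hodd'.sub_even he
        rw [hj]
        exact sub_eq_zero.2 (ih j (by lia) (by lia) (by exact_mod_cast hjodd))
    rw [← sum_subset (s₁ := {-1, 0}) (fun k hk => by
        simp only [mem_insert, mem_singleton] at hk
        rw [mem_Icc]; lia)
      (fun k _ hk => by
        simp only [mem_insert, mem_singleton, not_or] at hk
        rw [hzero k hk.1 hk.2, mul_zero]), sum_pair (by norm_num)] at hrec
    norm_num at hrec
    rcases hrec with h | h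
    · lia
    · exact sub_eq_zero.1 h

lemma sum_factorPairs_eq_sum_divisors {R : ℤ} {m : ℕ} (hm : (m : ℤ) ≤ R) (hpos : 0 < m) :
    ∑ v ∈ factorPairs R m, v.1 = ((∑ d ∈ m.divisors, d : ℕ) : ℤ) := by
  rw [Nat.cast_sum]
  symm
  refine sum_bij' (fun d _ => ((d : ℤ), ((m / d : ℕ) : ℤ))) (fun v _ => v.1.toNat) ?_ ?_ ?_ ?_ ?_
  · intro d hd
    have hdvd := Nat.dvd_of_mem_divisors hd
    rw [mem_factorPairs hm]
    refine ⟨by exact_mod_cast Nat.pos_of_mem_divisors hd,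
      by exact_mod_cast Nat.div_pos (Nat.le_of_dvd hpos hdvd) (Nat.pos_of_mem_divisors hd), ?_⟩
    exact_mod_cast Nat.mul_div_cancel' hdvd
  · rintro ⟨a, d⟩ h
    obtain ⟨ha, hd, h⟩ := (mem_factorPairs hm a d).1 h
    lift a to ℕ using ha.le
    lift d to ℕ using hd.le
    rw [Nat.mem_divisors]
    exact ⟨⟨d, by exact_mod_cast h.symm⟩, hpos.ne'⟩
  · intro d _
    simp
  · rintro ⟨a, d⟩ h
    obtain ⟨ha, hd, h⟩ := (mem_factorPairs hm a d).1 h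
    lift a to ℕ using ha.le
    lift d to ℕ using hd.le
    have h' : a * d = m := by exact_mod_cast h
    simp [← h', Nat.mul_div_cancel_left d (by exact_mod_cast ha : 0 < a)]
  · intro d _
    rfl

/-- From `x = 2(p+q+1)`, `y = 2(p-q)`, `z = 2r+1`, `w = 2s+1` one gets
`x² + y² + 2z² + 2w² = 2 ((2p+1)² + (2q+1)² + (2r+1)² + (2s+1)²)`. -/
lemma bijOn_oddQuadruples {m : ℕ} (hm : Odd m) :
    Set.BijOn (fun v : ℤ × ℤ × ℤ × ℤ =>
        (2 * (v.1 + v.2.1 + 1), 2 * (v.1 - v.2.1), 2 * v.2.2.1 + 1, 2 * v.2.2.2 + 1))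
      (oddQuadruples m m : Set (ℤ × ℤ × ℤ × ℤ))
      {v : ℤ × ℤ × ℤ × ℤ |
        v.1 ^ 2 + v.2.1 ^ 2 + 2 * v.2.2.1 ^ 2 + 2 * v.2.2.2 ^ 2 = (8 * m : ℤ) ∧
        Even v.1 ∧ Even v.2.1 ∧ Odd v.2.2.1 ∧ Odd v.2.2.2} := by
  refine ⟨?_, ?_, ?_⟩
  · rintro ⟨p, q, r, s⟩ h
    rw [mem_coe, mem_oddQuadruples le_rfl] at h
    exact ⟨by rw [← h]; ring, even_two_mul _, even_two_mul _, odd_two_mul_add_one _,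
      odd_two_mul_add_one _⟩
  · rintro ⟨p, q, r, s⟩ - ⟨p', q', r', s'⟩ - h
    simp only [Prod.mk.injEq] at h ⊢
    lia
  · rintro ⟨x, y, z, w⟩ ⟨h, hx, hy, ⟨r, rfl⟩, ⟨s, rfl⟩⟩
    obtain ⟨a, rfl⟩ := hx.two_dvd
    obtain ⟨b, rfl⟩ := hy.two_dvd
    simp only at h
    have hab : Odd (a + b) := by
      have hm' : Odd (m : ℤ) := by exact_mod_cast hm
      have : Odd (a ^ 2 + b ^ 2) :=
        ⟨m - (r ^ 2 + r) - (s ^ 2 + s) - 1, by linarith⟩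
      simpa [Int.odd_add, Int.odd_pow, Int.even_pow, parity_simps] using this
    obtain ⟨c, hc⟩ := hab
    obtain rfl : a = 2 * c + 1 - b := by lia
    refine ⟨(c, c - b, r, s), ?_, ?_⟩
    · rw [mem_coe, mem_oddQuadruples le_rfl]
      linarith
    · simp only [Prod.mk.injEq]
      lia

end FourOddSquares

open FourOddSquares


/-- For `m` odd and positive, the number of representations of `8m` by
`x² + y² + 2z² + 2w²` with `x, y` even and `z, w` odd is `16σ(m)`. -/
theorem representation_count_eight_m_even_even_odd_odd (m : ℕ) (hm : Odd m) (hpos : 0 < m) :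
    Nat.card {v : ℤ × ℤ × ℤ × ℤ //
        v.1 ^ 2 + v.2.1 ^ 2 + 2 * v.2.2.1 ^ 2 + 2 * v.2.2.2 ^ 2 = (8 * m : ℤ) ∧
        Even v.1 ∧ Even v.2.1 ∧ Odd v.2.2.1 ∧ Odd v.2.2.2} =
      16 * ∑ d ∈ m.divisors, d := by
  refine (Nat.card_congr (bijOn_oddQuadruples hm).equiv).symm.trans ?_
  rw [Nat.card_eq_card_toFinset,
    Finset.toFinset_coe]
  have h := card_oddQuadruples (R := m) m le_rfl hm
  rw [sum_factorPairs_eq_sum_divisors le_rfl hpos] at h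
  exact_mod_cast h
end

section
/- Let m be an odd positive integer. The set of primary quaternions q ∈ H₍₁,₂,₂₎ with N(q) = m is finite, and its cardinality equals σ(m), the sum of the positive divisors of m. -/
open Quaternion

noncomputable section

/-- `v₁ = 1` -/
def v₁ : ℍ[ℝ] := 1

/-- `v₂ = i` -/
def v₂ : ℍ[ℝ] := ⟨0, 1, 0, 0⟩

/-- `v₃ = (1 + i + √2·j)/2` -/
def v₃ : ℍ[ℝ] := ⟨1/2, 1/2, Real.sqrt 2 / 2, 0⟩

/-- `v₄ = (1 + i + √2·k)/2` -/
def v₄ : ℍ[ℝ] := ⟨1/2, 1/2, 0, Real.sqrt 2 / 2⟩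

/-- The quaternion order `H₍₁,₂,₂₎`: the ℤ-span of `{v₁, v₂, v₃, v₄}`. -/
def H122 : Set ℍ[ℝ] :=
  {q | ∃ a b c d : ℤ, q = a • v₁ + b • v₂ + c • v₃ + d • v₄}

/-- `q` is primary: `q ∈ H₍₁,₂,₂₎` and `q − 1` or `q − (1 + 2v₃)` lies in `2(1+i)·H₍₁,₂,₂₎`. -/
def Primary (q : ℍ[ℝ]) : Prop :=
  q ∈ H122 ∧
    ((∃ h ∈ H122, q - 1 = 2 * (1 + v₂) * h) ∨
     (∃ h ∈ H122, q - (1 + 2 * v₃) = 2 * (1 + v₂) * h))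

/-- Indefinite integral binary quadratic forms `(a, b, c)` of discriminant `N` with
`a > 0 > c`. -/
def simpleForms (N : ℤ) : Finset (ℤ × ℤ × ℤ) :=
  (Finset.Icc (-N) N ×ˢ Finset.Icc (-N) N ×ˢ Finset.Icc (-N) N).filter
    fun t => 0 < t.1 ∧ t.2.2 < 0 ∧ t.2.1 ^ 2 - 4 * t.1 * t.2.2 = N

lemma mem_simpleForms {N a b c : ℤ} :
    (a, b, c) ∈ simpleForms N ↔ 0 < a ∧ c < 0 ∧ b ^ 2 - 4 * a * c = N := by
  simp only [simpleForms, Finset.mem_filter, Finset.mem_product, Finset.mem_Icc,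
    and_iff_right_iff_imp]
  rintro ⟨ha, hc, rfl⟩
  have h1 : 0 ≤ (a - 1) * (-c) := mul_nonneg (by omega) (by omega)
  have h2 : 0 ≤ a * (-c - 1) := mul_nonneg (by omega) (by omega)
  have h3 := sq_nonneg b
  have h4 : b ≤ b ^ 2 := Int.le_self_sq b
  have h5 : -b ≤ b ^ 2 := by simpa using Int.le_self_sq (-b)
  refine ⟨⟨?_, ?_⟩, ⟨?_, ?_⟩, ?_, ?_⟩ <;> nlinarith

/-- The simple forms taking a positive value at `(1, 1)`. -/
def posSimpleForms (N : ℤ) : Finset (ℤ × ℤ × ℤ) :=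
  (simpleForms N).filter fun t => 0 < t.1 + t.2.1 + t.2.2

lemma mem_posSimpleForms {N a b c : ℤ} :
    (a, b, c) ∈ posSimpleForms N ↔
      (0 < a ∧ c < 0 ∧ b ^ 2 - 4 * a * c = N) ∧ 0 < a + b + c := by
  simp [posSimpleForms, mem_simpleForms]

lemma sq_ne_of_mod_eight {N : ℤ} (hN : N % 8 = 5) (x : ℤ) : x ^ 2 ≠ N := by
  rintro rfl
  have h : x % 8 = 0 ∨ x % 8 = 1 ∨ x % 8 = 2 ∨ x % 8 = 3 ∨ x % 8 = 4 ∨ x % 8 = 5 ∨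
    x % 8 = 6 ∨ x % 8 = 7 := by omega
  rcases h with h | h | h | h | h | h | h | h <;> simp [pow_two, Int.mul_emod, h] at hN

lemma sum_simpleForms_eq {N : ℤ} (hN : N % 8 = 5) (f : ℤ → ℤ → ℤ → ℤ) :
    ∑ t ∈ simpleForms N, f t.1 t.2.1 t.2.2 =
      ∑ t ∈ posSimpleForms N, (f t.1 t.2.1 t.2.2 + f (-t.2.2) (-t.2.1) (-t.1)) := by
  rw [Finset.sum_add_distrib, posSimpleForms,
    ← Finset.sum_filter_add_sum_filter_not (simpleForms N) (fun t => 0 < t.1 + t.2.1 + t.2.2)]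
  congr 1
  refine Finset.sum_nbij' (fun t => (-t.2.2, -t.2.1, -t.1)) (fun t => (-t.2.2, -t.2.1, -t.1))
    ?_ ?_ ?_ ?_ ?_
  · rintro ⟨a, b, c⟩ h
    simp only [Finset.mem_filter, mem_simpleForms] at h ⊢
    obtain ⟨⟨ha, hc, h⟩, he⟩ := h
    have hne : a + b + c ≠ 0 := fun h0 => sq_ne_of_mod_eight hN (a - c) (by
      rw [← h, show b = -(a + c) by omega]; ring)
    exact ⟨⟨by omega, by omega, by rw [← h]; ring⟩, by omega⟩
  · rintro ⟨a, b, c⟩ h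
    simp only [Finset.mem_filter, mem_simpleForms] at h ⊢
    obtain ⟨⟨ha, hc, h⟩, he⟩ := h
    exact ⟨⟨by omega, by omega, by rw [← h]; ring⟩, by omega⟩
  · simp
  · simp
  · simp

lemma sum_posSimpleForms_comp (N : ℤ) (f : ℤ → ℤ → ℤ → ℤ) :
    ∑ t ∈ posSimpleForms N, f t.1 t.2.1 t.2.2 =
      ∑ t ∈ posSimpleForms N, f (t.1 + t.2.1 + t.2.2) (-t.2.1 - 2 * t.2.2) t.2.2 := by
  refine Finset.sum_nbij' (fun t => (t.1 + t.2.1 + t.2.2, -t.2.1 - 2 * t.2.2, t.2.2))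
    (fun t => (t.1 + t.2.1 + t.2.2, -t.2.1 - 2 * t.2.2, t.2.2)) ?_ ?_ ?_ ?_ ?_
  iterate 2
    rintro ⟨a, b, c⟩ h
    rw [mem_posSimpleForms] at h ⊢
    obtain ⟨⟨ha, hc, h⟩, he⟩ := h
    exact ⟨⟨he, hc, by rw [← h]; ring⟩, by linarith⟩
  iterate 2
    rintro ⟨a, b, c⟩ -
    ext <;> dsimp only <;> ring
  · rintro ⟨a, b, c⟩ -
    dsimp only
    congr 1 <;> ring

lemma sum_simpleForms_neg (N : ℤ) (f : ℤ → ℤ → ℤ → ℤ) :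
    ∑ t ∈ simpleForms N, f t.1 t.2.1 t.2.2 = ∑ t ∈ simpleForms N, f t.1 (-t.2.1) t.2.2 := by
  refine Finset.sum_nbij' (fun t => (t.1, -t.2.1, t.2.2)) (fun t => (t.1, -t.2.1, t.2.2))
    ?_ ?_ ?_ ?_ ?_
  iterate 2
    rintro ⟨a, b, c⟩ h
    simpa [mem_simpleForms] using h
  all_goals simp

lemma sum_simpleForms_eq_zero {N : ℤ} (hN : N % 8 = 5) :
    ∑ t ∈ simpleForms N, (N - 5 * t.2.1 ^ 2) * t.1 = 0 := by
  have h1 : ∑ t ∈ simpleForms N, t.2.1 * t.1 ^ 2 = 0 := by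
    have := sum_simpleForms_neg N fun a b _ => b * a ^ 2
    simp only [neg_mul, Finset.sum_neg_distrib] at this
    omega
  rw [sum_simpleForms_eq hN fun a b _ => b * a ^ 2] at h1
  have h2 := sum_posSimpleForms_comp N
    fun a b c => b * a ^ 2 + -b * (-c) ^ 2
  have h3 : ∑ t ∈ simpleForms N, (N - 5 * t.2.1 ^ 2) * t.1 =
      ∑ t ∈ simpleForms N, (-4 * t.1 * t.2.2 - 4 * t.2.1 ^ 2) * t.1 := by
    refine Finset.sum_congr rfl ?_
    rintro ⟨a, b, c⟩ h
    rw [mem_simpleForms] at h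
    dsimp only
    rw [← h.2.2]
    ring
  rw [sum_simpleForms_eq hN fun a b c => (-4 * a * c - 4 * b ^ 2) * a] at h3
  have h4 := sum_posSimpleForms_comp N fun a b c =>
    (-4 * a * c - 4 * b ^ 2) * a + (-4 * -c * -a - 4 * (-b) ^ 2) * -c
  have h5 : ∑ t ∈ posSimpleForms N, ((-4 * t.1 * t.2.2 - 4 * t.2.1 ^ 2) * t.1 +
        (-4 * -t.2.2 * -t.1 - 4 * (-t.2.1) ^ 2) * -t.2.2) +
      ∑ t ∈ posSimpleForms N,
        ((-4 * (t.1 + t.2.1 + t.2.2) * t.2.2 - 4 * (-t.2.1 - 2 * t.2.2) ^ 2) *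
          (t.1 + t.2.1 + t.2.2) +
        (-4 * -t.2.2 * -(t.1 + t.2.1 + t.2.2) - 4 * (-(-t.2.1 - 2 * t.2.2)) ^ 2) * -t.2.2) =
      4 * (∑ t ∈ posSimpleForms N, (t.2.1 * t.1 ^ 2 + -t.2.1 * (-t.2.2) ^ 2) +
      ∑ t ∈ posSimpleForms N, ((-t.2.1 - 2 * t.2.2) * (t.1 + t.2.1 + t.2.2) ^ 2 +
        -(-t.2.1 - 2 * t.2.2) * (-t.2.2) ^ 2)) := by
    rw [← Finset.sum_add_distrib, ← Finset.sum_add_distrib, Finset.mul_sum]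
    exact Finset.sum_congr rfl fun t _ => by ring
  omega

/-- Vectors with `k` coordinates, all congruent to `1` modulo `4`, whose squares sum to `n`. -/
def oddSquares (k : ℕ) (n : ℤ) : Finset (Fin k → ℤ) :=
  (Fintype.piFinset fun _ => Finset.Icc (-n) n).filter
    fun x => (∀ i, x i % 4 = 1) ∧ ∑ i, x i ^ 2 = n

lemma mem_oddSquares {k : ℕ} {n : ℤ} {x : Fin k → ℤ} :
    x ∈ oddSquares k n ↔ (∀ i, x i % 4 = 1) ∧ ∑ i, x i ^ 2 = n := by
  simp only [oddSquares, Finset.mem_filter, Fintype.mem_piFinset, Finset.mem_Icc,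
    and_iff_right_iff_imp]
  rintro ⟨-, rfl⟩ i
  have h : x i ^ 2 ≤ ∑ j, x j ^ 2 :=
    Finset.single_le_sum (f := fun j => x j ^ 2) (fun j _ => sq_nonneg _) (Finset.mem_univ i)
  have h4 := Int.le_self_sq (x i)
  have h5 : -x i ≤ x i ^ 2 := by simpa using Int.le_self_sq (-x i)
  constructor <;> linarith

lemma sum_oddSquares_succ (k : ℕ) (n : ℤ) (f : ℤ → ℤ) :
    ∑ x ∈ oddSquares (k + 1) n, f (x 0) =
      ∑ y ∈ (Finset.Icc (-n) n).filter (fun y => y % 4 = 1),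
        f y * (oddSquares k (n - y ^ 2)).card := by
  have hmaps : ∀ x ∈ oddSquares (k + 1) n,
      x 0 ∈ (Finset.Icc (-n) n).filter (fun y => y % 4 = 1) := by
    intro x hx
    have h := hx
    simp only [oddSquares, Finset.mem_filter, Fintype.mem_piFinset] at h ⊢
    exact ⟨h.1 0, h.2.1 0⟩
  rw [← Finset.sum_fiberwise_of_maps_to hmaps]
  refine Finset.sum_congr rfl fun y hy => ?_
  rw [Finset.mem_filter] at hy
  rw [Finset.sum_congr rfl (g := fun _ => f y)
    (fun x hx => by rw [(Finset.mem_filter.1 hx).2]), Finset.sum_const, nsmul_eq_mul, mul_comm]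
  congr 2
  refine Finset.card_nbij' (fun x => Fin.tail x) (fun x => Fin.cons y x) ?_ ?_ ?_ ?_
  · intro x hx
    simp only [Finset.coe_filter, Set.mem_ofPred_eq, mem_oddSquares, Fin.sum_univ_succ] at hx
    simp only [Finset.mem_coe, mem_oddSquares, Fin.tail]
    exact ⟨fun i => hx.1.1 _, by rw [← hx.1.2, hx.2]; ring⟩
  · intro x hx
    simp only [Finset.mem_coe, mem_oddSquares] at hx
    simp only [Finset.coe_filter, Set.mem_ofPred_eq, mem_oddSquares, Fin.sum_univ_succ,
      Fin.cons_zero, Fin.cons_succ, Fin.forall_fin_succ]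
    exact ⟨⟨⟨hy.2, hx.1⟩, by rw [hx.2]; ring⟩, trivial⟩
  · intro x hx
    simp only [Finset.coe_filter, Set.mem_ofPred_eq] at hx
    simp only [← hx.2, Fin.cons_self_tail]
  · intro x _
    simp

lemma sum_oddSquares_apply_sq (k : ℕ) (n : ℤ) (i : Fin (k + 1)) :
    ∑ x ∈ oddSquares (k + 1) n, x i ^ 2 = ∑ x ∈ oddSquares (k + 1) n, x 0 ^ 2 := by
  refine Finset.sum_nbij' (fun x => x ∘ Equiv.swap 0 i) (fun x => x ∘ Equiv.swap 0 i)
    ?_ ?_ ?_ ?_ ?_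
  iterate 2
    intro x hx
    rw [mem_oddSquares] at hx ⊢
    exact ⟨fun j => hx.1 _, by
      rw [← hx.2]; exact Equiv.sum_comp (Equiv.swap 0 i) fun j => x j ^ 2⟩
  iterate 2
    intro x _
    ext j
    simp
  · simp

lemma sum_mul_card_oddSquares (k : ℕ) (n : ℤ) :
    ∑ y ∈ (Finset.Icc (-n) n).filter (fun y => y % 4 = 1),
      (n - (k + 1) * y ^ 2) * (oddSquares k (n - y ^ 2)).card = 0 := by
  rw [← sum_oddSquares_succ k n fun y => n - (k + 1) * y ^ 2, Finset.sum_sub_distrib,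
    ← Finset.mul_sum]
  have h : ∑ x ∈ oddSquares (k + 1) n, n = ∑ x ∈ oddSquares (k + 1) n, ∑ i, x i ^ 2 :=
    Finset.sum_congr rfl fun x hx => (mem_oddSquares.1 hx).2.symm
  rw [h, Finset.sum_comm]
  simp [sum_oddSquares_apply_sq]

/-- The divisor sum of `n / 4` for positive `n`, and zero otherwise. -/
def quarterSigma (n : ℤ) : ℤ :=
  if 0 < n then ∑ d ∈ (n / 4).toNat.divisors, (d : ℤ) else 0

lemma sq_mod_eight_of_mod_four {y : ℤ} (hy : y % 4 = 1 ∨ y % 4 = 3) : y ^ 2 % 8 = 1 := by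
  have h : y % 8 = 1 ∨ y % 8 = 3 ∨ y % 8 = 5 ∨ y % 8 = 7 := by omega
  rcases h with h | h | h | h <;> simp [pow_two, Int.mul_emod, h]

lemma sum_fst_simpleForms_fiber {N b : ℤ} (hN : N % 8 = 5) (hb : b % 4 = 1) :
    ∑ t ∈ (simpleForms N).filter (fun t => t.2.1 = b), t.1 = quarterSigma (N - b ^ 2) := by
  have hb8 := sq_mod_eight_of_mod_four (Or.inl hb)
  unfold quarterSigma
  split_ifs with hpos
  · obtain ⟨m, hm⟩ : ∃ m : ℕ, N - b ^ 2 = 4 * m := ⟨((N - b ^ 2) / 4).toNat, by omega⟩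
    have hm' : ((N - b ^ 2) / 4).toNat = m := by omega
    have hm0 : m ≠ 0 := by omega
    rw [hm']
    refine Finset.sum_nbij' (fun t => t.1.toNat) (fun d => ((d : ℤ), b, -((m / d : ℕ) : ℤ)))
      ?_ ?_ ?_ ?_ ?_
    · rintro ⟨a, b', c⟩ h
      rw [Finset.mem_filter, mem_simpleForms] at h
      obtain ⟨⟨ha, hc, h⟩, rfl : b' = b⟩ := h
      refine Nat.mem_divisors.2 ⟨?_, hm0⟩
      rw [← Int.natCast_dvd_natCast, Int.toNat_of_nonneg ha.le]
      exact ⟨-c, by linarith⟩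
    · intro d hd
      obtain ⟨⟨e, rfl⟩, -⟩ := Nat.mem_divisors.1 hd
      have hd0 : 0 < d := Nat.pos_of_ne_zero fun h => hm0 (by simp [h])
      have he0 : 0 < e := Nat.pos_of_ne_zero fun h => hm0 (by simp [h])
      rw [Finset.mem_filter, mem_simpleForms, Nat.mul_div_cancel_left _ hd0]
      push_cast at hm
      exact ⟨⟨by omega, by omega, by linarith⟩, rfl⟩
    · rintro ⟨a, b', c⟩ h
      rw [Finset.mem_filter, mem_simpleForms] at h
      obtain ⟨⟨ha, hc, h⟩, rfl : b' = b⟩ := h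
      have hac : (m : ℤ) = a * -c := by linarith
      ext
      · simp [ha.le]
      · rfl
      · simp [ha.le, hac, -mul_neg, Int.mul_ediv_cancel_left _ ha.ne']
    · intro d _
      simp
    · rintro ⟨a, b', c⟩ h
      rw [Finset.mem_filter, mem_simpleForms] at h
      simp [h.1.1.le]
  · refine Finset.sum_eq_zero ?_
    rintro ⟨a, b', c⟩ h
    rw [Finset.mem_filter, mem_simpleForms] at h
    obtain ⟨⟨ha, hc, h⟩, rfl : b' = b⟩ := h
    nlinarith [mul_pos ha (neg_pos.2 hc)]

lemma sum_mul_quarterSigma {N : ℤ} (hN : N % 8 = 5) :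
    ∑ y ∈ (Finset.Icc (-N) N).filter (fun y => y % 4 = 1),
      (N - 5 * y ^ 2) * quarterSigma (N - y ^ 2) = 0 := by
  have hodd : ∀ t ∈ simpleForms N, t.2.1 % 4 = 1 ∨ t.2.1 % 4 = 3 := by
    rintro ⟨a, b, c⟩ h
    rw [mem_simpleForms] at h
    by_contra hb
    obtain ⟨k, rfl⟩ : ∃ k, b = 2 * k := ⟨b / 2, by dsimp only at hb; omega⟩
    have : 4 * (k ^ 2 - a * c) = N := by linarith [h.2.2]
    omega
  have h0 := sum_simpleForms_eq_zero hN
  rw [← Finset.sum_filter_add_sum_filter_not _ (fun t => t.2.1 % 4 = 1)] at h0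
  have hneg : ∑ t ∈ (simpleForms N).filter (fun t => ¬ t.2.1 % 4 = 1),
      (N - 5 * t.2.1 ^ 2) * t.1 = ∑ t ∈ (simpleForms N).filter (fun t => t.2.1 % 4 = 1),
      (N - 5 * t.2.1 ^ 2) * t.1 := by
    refine Finset.sum_nbij' (fun t => (t.1, -t.2.1, t.2.2)) (fun t => (t.1, -t.2.1, t.2.2))
      ?_ ?_ ?_ ?_ ?_
    · rintro ⟨a, b, c⟩ h
      have := hodd _ (Finset.mem_filter.1 h).1
      simp only [Finset.mem_filter, mem_simpleForms, neg_sq] at h this ⊢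
      exact ⟨h.1, by omega⟩
    · rintro ⟨a, b, c⟩ h
      simp only [Finset.mem_filter, mem_simpleForms, neg_sq] at h ⊢
      exact ⟨h.1, by omega⟩
    all_goals simp
  have hmaps : ∀ t ∈ (simpleForms N).filter (fun t => t.2.1 % 4 = 1),
      t.2.1 ∈ (Finset.Icc (-N) N).filter (fun y => y % 4 = 1) := by
    intro t h
    simp only [simpleForms, Finset.mem_filter, Finset.mem_product] at h ⊢
    exact ⟨h.1.1.2.1, h.2⟩
  rw [hneg, ← Finset.sum_fiberwise_of_maps_to hmaps] at h0
  have hsum : ∀ y ∈ (Finset.Icc (-N) N).filter (fun y => y % 4 = 1),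
      ∑ t ∈ ((simpleForms N).filter (fun t => t.2.1 % 4 = 1)).filter (fun t => t.2.1 = y),
        (N - 5 * t.2.1 ^ 2) * t.1 = (N - 5 * y ^ 2) * quarterSigma (N - y ^ 2) := by
    intro y hy
    have hy := (Finset.mem_filter.1 hy).2
    rw [← sum_fst_simpleForms_fiber hN hy, Finset.mul_sum, Finset.filter_filter]
    refine Finset.sum_congr (Finset.filter_congr fun t _ => ?_) fun t ht => ?_
    · exact and_iff_right_of_imp fun h => h ▸ hy
    · rw [(Finset.mem_filter.1 ht).2]
  rw [Finset.sum_congr rfl hsum] at h0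
  omega

lemma card_oddSquares_four_four : (oddSquares 4 4).card = 1 := by
  refine Finset.card_eq_one.2 ⟨fun _ => 1, ?_⟩
  ext x
  simp only [mem_oddSquares, Finset.mem_singleton]
  constructor
  · rintro ⟨h, hs⟩
    have h1 : ∀ i, 1 ≤ x i ^ 2 := fun i => by
      have := sq_mod_eight_of_mod_four (Or.inl (h i))
      have := sq_nonneg (x i)
      omega
    simp only [Fin.sum_univ_four] at hs
    have h2 : ∀ i, x i ^ 2 = 1 := by
      have := h1 0; have := h1 1; have := h1 2; have := h1 3
      intro i
      fin_cases i <;> dsimp <;> omega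
    ext i
    have := h i
    rcases sq_eq_one_iff.1 (h2 i) with h | h <;> omega
  · rintro rfl
    simp

/-- Jacobi's theorem: `4 m`, for `m` odd, has `σ(m)` representations as a sum of four squares of
integers congruent to `1` modulo `4`. -/
theorem card_oddSquares_four (m : ℕ) (hm : Odd m) :
    ((oddSquares 4 (4 * m)).card : ℤ) = ∑ d ∈ m.divisors, (d : ℤ) := by
  induction m using Nat.strong_induction_on with
  | _ m ih =>
  have hodd := Nat.odd_iff.1 hm
  rcases eq_or_ne m 1 with rfl | hm1
  · simp [card_oddSquares_four_four]
  set N : ℤ := 4 * m + 1 with hNdef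
  have hN : N % 8 = 5 := by omega
  have h1 := sum_mul_card_oddSquares 4 N
  have h2 := sum_mul_quarterSigma hN
  have h3 : ∑ y ∈ (Finset.Icc (-N) N).filter (fun y => y % 4 = 1), (N - 5 * y ^ 2) *
      ((oddSquares 4 (N - y ^ 2)).card - quarterSigma (N - y ^ 2)) = 0 := by
    simp only [mul_sub _ ((oddSquares 4 _).card : ℤ), Finset.sum_sub_distrib, h2, sub_zero]
    rw [← h1]
    norm_num
  rw [Finset.sum_eq_single_of_mem 1] at h3
  · have h4 : N - 1 ^ 2 = 4 * m := by rw [hNdef]; ring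
    rcases mul_eq_zero.1 h3 with h | h
    · omega
    · rw [h4, quarterSigma, if_pos (by omega), Int.mul_ediv_cancel_left _ (by norm_num),
        Int.toNat_natCast] at h
      linarith
  · simp only [Finset.mem_filter, Finset.mem_Icc]
    omega
  · intro y hy hy1
    have hy := (Finset.mem_filter.1 hy).2
    have hy8 := sq_mod_eight_of_mod_four (Or.inl hy)
    have hlt : 1 < y ^ 2 := by
      have := sq_nonneg y
      rcases (show y ≤ -3 ∨ 5 ≤ y by omega) with h | h <;> nlinarith
    by_cases hpos : 0 < N - y ^ 2
    · obtain ⟨k, hk⟩ : ∃ k : ℕ, N - y ^ 2 = 4 * k := ⟨((N - y ^ 2) / 4).toNat, by omega⟩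
      rw [hk, ih k (by omega) (Nat.odd_iff.2 (by omega)), quarterSigma, if_pos (by omega),
        Int.mul_ediv_cancel_left _ (by norm_num), Int.toNat_natCast, sub_self, mul_zero]
    · have hempty : oddSquares 4 (N - y ^ 2) = ∅ := by
        refine Finset.eq_empty_of_forall_notMem fun x hx => ?_
        obtain ⟨hx, hs⟩ := mem_oddSquares.1 hx
        have h0 : x 0 ^ 2 ≤ ∑ j, x j ^ 2 := Finset.single_le_sum (f := fun j => x j ^ 2)
          (fun j _ => sq_nonneg _) (Finset.mem_univ 0)
        have := sq_mod_eight_of_mod_four (Or.inl (hx 0))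
        have := sq_nonneg (x 0)
        omega
      rw [quarterSigma, if_neg hpos, hempty]
      simp

/-- The quaternion attached to a vector of four integers. -/
def quaternionOfVec (x : Fin 4 → ℤ) : ℍ[ℝ] :=
  ⟨(x 0 + x 1 + x 2 + x 3) / 4, (x 0 + x 1 - x 2 - x 3) / 4,
    Real.sqrt 2 * ((x 0 - x 1) / 4), Real.sqrt 2 * ((x 2 - x 3) / 4)⟩

@[simp] lemma quaternionOfVec_re (x : Fin 4 → ℤ) :
    (quaternionOfVec x).re = (x 0 + x 1 + x 2 + x 3) / 4 := rfl

@[simp] lemma quaternionOfVec_imI (x : Fin 4 → ℤ) :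
    (quaternionOfVec x).imI = (x 0 + x 1 - x 2 - x 3) / 4 := rfl

@[simp] lemma quaternionOfVec_imJ (x : Fin 4 → ℤ) :
    (quaternionOfVec x).imJ = Real.sqrt 2 * ((x 0 - x 1) / 4) := rfl

@[simp] lemma quaternionOfVec_imK (x : Fin 4 → ℤ) :
    (quaternionOfVec x).imK = Real.sqrt 2 * ((x 2 - x 3) / 4) := rfl

@[simp] lemma re_v₂ : v₂.re = 0 := rfl

@[simp] lemma imI_v₂ : v₂.imI = 1 := rfl

@[simp] lemma imJ_v₂ : v₂.imJ = 0 := rfl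

@[simp] lemma imK_v₂ : v₂.imK = 0 := rfl

@[simp] lemma re_v₃ : v₃.re = 1 / 2 := rfl

@[simp] lemma imI_v₃ : v₃.imI = 1 / 2 := rfl

@[simp] lemma imJ_v₃ : v₃.imJ = Real.sqrt 2 / 2 := rfl

@[simp] lemma imK_v₃ : v₃.imK = 0 := rfl

@[simp] lemma re_v₄ : v₄.re = 1 / 2 := rfl

@[simp] lemma imI_v₄ : v₄.imI = 1 / 2 := rfl

@[simp] lemma imJ_v₄ : v₄.imJ = 0 := rfl

@[simp] lemma imK_v₄ : v₄.imK = Real.sqrt 2 / 2 := rfl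

lemma quaternionOfVec_injective : Function.Injective quaternionOfVec := by
  intro x y h
  have hs : Real.sqrt 2 ≠ 0 := by positivity
  have h1 : (quaternionOfVec x).re = (quaternionOfVec y).re := by rw [h]
  have h2 : (quaternionOfVec x).imI = (quaternionOfVec y).imI := by rw [h]
  have h3 : (quaternionOfVec x).imJ = (quaternionOfVec y).imJ := by rw [h]
  have h4 : (quaternionOfVec x).imK = (quaternionOfVec y).imK := by rw [h]
  simp only [quaternionOfVec_re, quaternionOfVec_imI, quaternionOfVec_imJ, quaternionOfVec_imK,
    mul_right_inj' hs] at h1 h2 h3 h4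
  ext i
  rw [← Int.cast_inj (α := ℝ)]
  fin_cases i <;> dsimp <;> linarith

lemma quaternionOfVec_mul_star_eq_iff (x : Fin 4 → ℤ) (m : ℕ) :
    quaternionOfVec x * star (quaternionOfVec x) = (m : ℍ[ℝ]) ↔
      ∑ i, x i ^ 2 = 4 * (m : ℤ) := by
  have hs : Real.sqrt 2 ^ 2 = 2 := Real.sq_sqrt (by norm_num)
  have hcast : (m : ℍ[ℝ]) = ((m : ℝ) : ℍ[ℝ]) := rfl
  rw [Quaternion.self_mul_star, hcast, Quaternion.coe_inj, Quaternion.normSq_def',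
    ← Int.cast_inj (α := ℝ), Fin.sum_univ_four]
  push_cast
  simp only [quaternionOfVec_re, quaternionOfVec_imI, quaternionOfVec_imJ, quaternionOfVec_imK,
    mul_pow, hs]
  constructor <;> intro h <;> linarith

lemma one_add_two_mul_eq_quaternionOfVec (a b c d e : ℤ) :
    1 + e * (2 * v₃) + 2 * (1 + v₂) * (a • v₁ + b • v₂ + c • v₃ + d • v₄) =
      quaternionOfVec ![1 + 4 * (a + c + e), 1 + 4 * (a + d), 1 - 4 * b,
        1 - 4 * (b + c + d)] := by
  ext <;> simp [v₁, two_mul] <;> ring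

lemma mem_H122_one_add_two_mul (a b c d e : ℤ) :
    1 + e * (2 * v₃) + 2 * (1 + v₂) * (a • v₁ + b • v₂ + c • v₃ + d • v₄) ∈ H122 := by
  refine ⟨1 + 2 * (a - b - c), 2 * (a + b + d), 2 * (c - d) + 2 * e, 2 * (c + d), ?_⟩
  ext <;> simp [v₁, two_mul] <;> ring

lemma primary_iff (q : ℍ[ℝ]) :
    Primary q ↔ ∃ x : Fin 4 → ℤ, (∀ i, x i % 4 = 1) ∧ quaternionOfVec x = q := by
  constructor
  · rintro ⟨-, ⟨h, ⟨a, b, c, d, rfl⟩, hq⟩ | ⟨h, ⟨a, b, c, d, rfl⟩, hq⟩⟩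
    · refine ⟨_, fun i => ?_, (one_add_two_mul_eq_quaternionOfVec a b c d 0).symm.trans ?_⟩
      · fin_cases i <;> dsimp <;> omega
      · rw [← hq]; simp
    · refine ⟨_, fun i => ?_, (one_add_two_mul_eq_quaternionOfVec a b c d 1).symm.trans ?_⟩
      · fin_cases i <;> dsimp <;> omega
      · rw [← hq]; simp
  · rintro ⟨x, hx, rfl⟩
    have key : ∃ a b c d e : ℤ, (e = 0 ∨ e = 1) ∧
        x = ![1 + 4 * (a + c + e), 1 + 4 * (a + d), 1 - 4 * b, 1 - 4 * (b + c + d)] := by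
      have h0 := hx 0
      have h1 := hx 1
      have h2 := hx 2
      have h3 := hx 3
      set e := (x 0 / 4 + x 1 / 4 + x 2 / 4 + x 3 / 4) % 2 with he
      set a := (x 0 / 4 - e + x 1 / 4 - x 2 / 4 + x 3 / 4) / 2 with ha
      refine ⟨a, -(x 2 / 4), x 0 / 4 - e - a, x 1 / 4 - a, e, by omega, ?_⟩
      ext i
      fin_cases i <;> dsimp <;> omega
    obtain ⟨a, b, c, d, e, he, rfl⟩ := key
    rw [← one_add_two_mul_eq_quaternionOfVec]
    refine ⟨mem_H122_one_add_two_mul a b c d e, ?_⟩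
    rcases he with rfl | rfl
    · exact Or.inl ⟨_, ⟨a, b, c, d, rfl⟩, by simp⟩
    · exact Or.inr ⟨_, ⟨a, b, c, d, rfl⟩, by simp⟩

/-- For `m` odd and positive, the set of primary quaternions of norm `m` in `H₍₁,₂,₂₎`
is finite of cardinality `σ(m) = ∑_{d ∣ m} d`. -/
theorem primary_count (m : ℕ) (hm : Odd m) (hpos : 0 < m) :
    {q : ℍ[ℝ] | Primary q ∧ q * star q = (m : ℍ[ℝ])}.Finite ∧
    {q : ℍ[ℝ] | Primary q ∧ q * star q = (m : ℍ[ℝ])}.ncard = ∑ d ∈ m.divisors, d := by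
  have hset : {q : ℍ[ℝ] | Primary q ∧ q * star q = (m : ℍ[ℝ])} =
      quaternionOfVec '' (oddSquares 4 (4 * m) : Set (Fin 4 → ℤ)) := by
    ext q
    simp only [Set.mem_ofPred_eq, primary_iff, Set.mem_image, Finset.mem_coe, mem_oddSquares,
      ← quaternionOfVec_mul_star_eq_iff]
    constructor
    · rintro ⟨⟨x, hx, rfl⟩, h⟩
      exact ⟨x, ⟨hx, h⟩, rfl⟩
    · rintro ⟨x, ⟨hx, h⟩, rfl⟩
      exact ⟨⟨x, hx, rfl⟩, h⟩
  rw [hset]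
  refine ⟨(Finset.finite_toSet _).image _, ?_⟩
  rw [Set.ncard_image_of_injective _ quaternionOfVec_injective, Set.ncard_coe_finset]
  have h := card_oddSquares_four m hm
  rw [← Nat.cast_sum] at h
  exact_mod_cast h
end
end

section
/- Let m be an odd positive integer. The set of primitive quaternions c ∈ H₍₁,₂,₂₎ with N(c) = m is finite, and its cardinality equals m · ∏_{p ∣ m} (1 + 1/p), where the product runs over the distinct primes p dividing m. -/
open Quaternion

noncomputable section

/-- `c` is primitive: `c` is primary and its coordinates with respect to the ℤ-basis
`{v₁, v₂, v₃, v₄}` have gcd `1`. -/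
def Primitive (c : ℍ[ℝ]) : Prop :=
  Primary c ∧
    ∀ c₁ c₂ c₃ c₄ : ℤ, c = c₁ • v₁ + c₂ • v₂ + c₃ • v₃ + c₄ • v₄ →
      Int.gcd (Int.gcd c₁ c₂) (Int.gcd c₃ c₄) = 1

/-- The quadruples `(a, b, c, d)` over `R`, to be thought of as `a + b i + c v₃ + d v₄`;
for `R = ℤ` this is the order `H₍₁,₂,₂₎` in coordinates. -/
@[ext]
structure HOrder (R : Type*) where
  a : R
  b : R
  c : R
  d : R

namespace HOrder

section Ring

variable {R : Type*} [CommRing R]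

instance : Zero (HOrder R) := ⟨⟨0, 0, 0, 0⟩⟩
instance : One (HOrder R) := ⟨⟨1, 0, 0, 0⟩⟩
instance : Add (HOrder R) := ⟨fun x y => ⟨x.a + y.a, x.b + y.b, x.c + y.c, x.d + y.d⟩⟩
instance : Neg (HOrder R) := ⟨fun x => ⟨-x.a, -x.b, -x.c, -x.d⟩⟩
instance : Sub (HOrder R) := ⟨fun x y => ⟨x.a - y.a, x.b - y.b, x.c - y.c, x.d - y.d⟩⟩
instance : Mul (HOrder R) :=
  ⟨fun x y =>
    ⟨x.a * y.a - x.b * y.b - x.b * y.c - x.c * y.c - x.d * y.b - x.d * y.c - x.d * y.d,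
     x.a * y.b + x.b * y.a + x.b * y.d + x.c * y.b + x.c * y.d - x.d * y.c,
     x.a * y.c - x.b * y.d + x.c * y.a + x.c * y.c + x.d * y.b + x.d * y.c,
     x.a * y.d + x.b * y.c - x.c * y.b + x.d * y.a + x.d * y.c + x.d * y.d⟩⟩

@[simp] lemma zero_def : (0 : HOrder R) = ⟨0, 0, 0, 0⟩ := rfl
@[simp] lemma one_def : (1 : HOrder R) = ⟨1, 0, 0, 0⟩ := rfl
@[simp] lemma add_def (x y : HOrder R) :
    x + y = ⟨x.a + y.a, x.b + y.b, x.c + y.c, x.d + y.d⟩ := rfl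
@[simp] lemma neg_def (x : HOrder R) : -x = ⟨-x.a, -x.b, -x.c, -x.d⟩ := rfl
@[simp] lemma sub_def (x y : HOrder R) :
    x - y = ⟨x.a - y.a, x.b - y.b, x.c - y.c, x.d - y.d⟩ := rfl
@[simp] lemma mul_def (x y : HOrder R) :
    x * y =
      ⟨x.a * y.a - x.b * y.b - x.b * y.c - x.c * y.c - x.d * y.b - x.d * y.c - x.d * y.d,
       x.a * y.b + x.b * y.a + x.b * y.d + x.c * y.b + x.c * y.d - x.d * y.c,
       x.a * y.c - x.b * y.d + x.c * y.a + x.c * y.c + x.d * y.b + x.d * y.c,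
       x.a * y.d + x.b * y.c - x.c * y.b + x.d * y.a + x.d * y.c + x.d * y.d⟩ := rfl

instance : Ring (HOrder R) where
  add_assoc x y z := by ext <;> simp <;> ring
  zero_add x := by ext <;> simp
  add_zero x := by ext <;> simp
  add_comm x y := by ext <;> simp <;> ring
  neg_add_cancel x := by ext <;> simp
  sub_eq_add_neg x y := by ext <;> simp <;> ring
  mul_assoc x y z := by ext <;> simp <;> ring
  one_mul x := by ext <;> simp
  mul_one x := by ext <;> simp
  left_distrib x y z := by ext <;> simp <;> ring
  right_distrib x y z := by ext <;> simp <;> ring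
  zero_mul x := by ext <;> simp
  mul_zero x := by ext <;> simp
  nsmul := nsmulRec
  zsmul := zsmulRec

/-- The scalar `r` as an element of `HOrder R`. -/
def const (r : R) : HOrder R := ⟨r, 0, 0, 0⟩

/-- Quaternion conjugation. -/
def conj (x : HOrder R) : HOrder R := ⟨x.a + x.c + x.d, -x.b, -x.c, -x.d⟩

/-- The quaternion norm. -/
def norm (x : HOrder R) : R :=
  x.a ^ 2 + x.b ^ 2 + (x.a + x.b) * (x.c + x.d) + x.c ^ 2 + x.d ^ 2 + x.c * x.d

lemma const_mul (r : R) (x : HOrder R) : const r * x = ⟨r * x.a, r * x.b, r * x.c, r * x.d⟩ := by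
  ext <;> simp [const]

lemma const_mul_comm (r : R) (x : HOrder R) : const r * x = x * const r := by
  ext <;> simp [const] <;> ring

lemma mul_conj (x : HOrder R) : x * conj x = const (norm x) := by
  ext <;> simp [const, conj, norm] <;> ring

lemma conj_mul (x : HOrder R) : conj x * x = const (norm x) := by
  ext <;> simp [const, conj, norm] <;> ring

@[simp] lemma conj_conj (x : HOrder R) : conj (conj x) = x := by
  ext <;> simp [conj]
  ring

lemma conj_neg (x : HOrder R) : conj (-x) = -conj x := by
  simp [conj]; ring

lemma norm_mul (x y : HOrder R) : norm (x * y) = norm x * norm y := by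
  simp [norm]; ring

@[simp] lemma norm_conj (x : HOrder R) : norm (conj x) = norm x := by
  simp [norm, conj]; ring

@[simp] lemma norm_neg (x : HOrder R) : norm (-x) = norm x := by
  simp [norm]; ring

lemma norm_const (r : R) : norm (const r) = r ^ 2 := by
  simp [norm, const]

/-- Coordinatewise application of a map. -/
def map {S : Type*} (f : R → S) (x : HOrder R) : HOrder S := ⟨f x.a, f x.b, f x.c, f x.d⟩

lemma map_mul {S : Type*} [CommRing S] (f : R →+* S) (x y : HOrder R) :
    map f (x * y) = map f x * map f y := by
  ext <;> simp [map]

lemma norm_map {S : Type*} [CommRing S] (f : R →+* S) (x : HOrder R) :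
    norm (map f x) = f (norm x) := by
  simp [map, norm]

end Ring

section Euclid

lemma four_mul_norm (x : HOrder ℤ) :
    4 * norm x =
      (2 * x.a + x.c + x.d) ^ 2 + (2 * x.b + x.c + x.d) ^ 2 + 2 * x.c ^ 2 + 2 * x.d ^ 2 := by
  simp only [norm]; ring

lemma norm_nonneg (x : HOrder ℤ) : 0 ≤ norm x := by
  have := four_mul_norm x
  nlinarith [sq_nonneg (2 * x.a + x.c + x.d), sq_nonneg (2 * x.b + x.c + x.d), sq_nonneg x.c,
    sq_nonneg x.d]

lemma norm_eq_zero {x : HOrder ℤ} (h : norm x = 0) : x = 0 := by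
  have h4 := four_mul_norm x
  have h1 := sq_nonneg (2 * x.a + x.c + x.d)
  have h2 := sq_nonneg (2 * x.b + x.c + x.d)
  have h3 := sq_nonneg x.c
  have h5 := sq_nonneg x.d
  have hc : x.c = 0 := pow_eq_zero_iff (two_ne_zero) |>.1 (by linarith)
  have hd : x.d = 0 := pow_eq_zero_iff (two_ne_zero) |>.1 (by linarith)
  have ha : 2 * x.a + x.c + x.d = 0 := pow_eq_zero_iff (two_ne_zero) |>.1 (by linarith)
  have hb : 2 * x.b + x.c + x.d = 0 := pow_eq_zero_iff (two_ne_zero) |>.1 (by linarith)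
  ext <;> simp <;> omega

lemma const_mul_cancel {r : ℤ} (hr : r ≠ 0) {x y : HOrder ℤ} (h : const r * x = const r * y) :
    x = y := by
  simp only [const_mul, HOrder.mk.injEq, mul_eq_mul_left_iff, hr, or_false] at h
  exact HOrder.ext h.1 h.2.1 h.2.2.1 h.2.2.2

lemma mul_right_cancel_of_norm {x y z : HOrder ℤ} (hz : norm z ≠ 0) (h : x * z = y * z) :
    x = y := by
  apply const_mul_cancel hz
  rw [const_mul_comm, const_mul_comm, ← mul_conj, ← mul_assoc, ← mul_assoc, h]

lemma exists_abs_sub_le (w : ℤ) {n : ℤ} (hn : 0 < n) :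
    ∃ q, (w - 2 * (n * q)) ^ 2 ≤ n ^ 2 := by
  refine ⟨(w + n) / (2 * n), ?_⟩
  have h1 := Int.emod_add_mul_ediv (w + n) (2 * n)
  have h2 := Int.emod_nonneg (w + n) (show 2 * n ≠ 0 by omega)
  have h3 := Int.emod_lt_of_pos (w + n) (show 0 < 2 * n by omega)
  apply sq_le_sq'
  · linarith [mul_assoc 2 n ((w + n) / (2 * n))]
  · linarith [mul_assoc 2 n ((w + n) / (2 * n))]

lemma exists_norm_sub_lt (x : HOrder ℤ) {n : ℤ} (hn : 0 < n) :
    ∃ q, norm (x - const n * q) < n ^ 2 := by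
  obtain ⟨c, hc⟩ := exists_abs_sub_le (2 * x.c) hn
  obtain ⟨d, hd⟩ := exists_abs_sub_le (2 * x.d) hn
  obtain ⟨a, ha⟩ := exists_abs_sub_le (2 * x.a + (x.c - n * c) + (x.d - n * d)) hn
  obtain ⟨b, hb⟩ := exists_abs_sub_le (2 * x.b + (x.c - n * c) + (x.d - n * d)) hn
  refine ⟨⟨a, b, c, d⟩, ?_⟩
  have h := four_mul_norm (x - const n * ⟨a, b, c, d⟩)
  simp only [const_mul, sub_def] at h ⊢
  nlinarith

lemma exists_norm_sub_mul_lt (x : HOrder ℤ) {y : HOrder ℤ} (hy : y ≠ 0) :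
    ∃ q, norm (x - q * y) < norm y := by
  have hn : 0 < norm y := lt_of_le_of_ne (norm_nonneg y) fun h => hy (norm_eq_zero h.symm)
  obtain ⟨q, hq⟩ := exists_norm_sub_lt (x * conj y) hn
  refine ⟨q, ?_⟩
  have : x * conj y - const (norm y) * q = (x - q * y) * conj y := by
    rw [sub_mul, mul_assoc q, mul_conj, const_mul_comm]
  rw [this, norm_mul, norm_conj] at hq
  nlinarith

/-- Any two elements have a greatest common right divisor, with a Bézout relation. -/
lemma exists_gcd (x y : HOrder ℤ) :
    ∃ g r s u v : HOrder ℤ, g = r * x + s * y ∧ x = u * g ∧ y = v * g := by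
  induction hn : (norm y).toNat using Nat.strong_induction_on generalizing x y with
  | _ n ih =>
    by_cases hy : y = 0
    · exact ⟨x, 1, 0, 1, 0, by rw [one_mul, zero_mul, add_zero], by rw [one_mul],
        by rw [zero_mul, hy]⟩
    · obtain ⟨q, hq⟩ := exists_norm_sub_mul_lt x hy
      obtain ⟨g, r, s, u, v, hg, hu, hv⟩ := ih _ (by
        have := norm_nonneg (x - q * y); omega) y (x - q * y) rfl
      refine ⟨g, s, r - s * q, v + q * u, u, ?_, ?_, hu⟩
      · rw [hg]; noncomm_ring
      · rw [add_mul, ← hv, mul_assoc, ← hu]; noncomm_ring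

end Euclid

section Primary

/-- The residue classes modulo `4` of the primary elements. -/
def IsPrimary (x : HOrder (ZMod 4)) : Prop :=
  2 * x.b = 0 ∧ 2 * x.c = 0 ∧ 2 * x.d = 0 ∧
    ((x.c = x.d ∧ x.a + x.b + x.c = 1) ∨ (x.c = x.d + 2 ∧ x.a + x.b + x.c = 3))

instance (x : HOrder (ZMod 4)) : Decidable (IsPrimary x) := by
  unfold IsPrimary; infer_instance

/-- Reduction modulo `4`. -/
def red (x : HOrder ℤ) : HOrder (ZMod 4) := map (Int.castRingHom (ZMod 4)) x

lemma red_mul (x y : HOrder ℤ) : red (x * y) = red x * red y := map_mul _ x y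

lemma IsPrimary.mul {x y : HOrder (ZMod 4)} (hx : IsPrimary x) (hy : IsPrimary y) :
    IsPrimary (x * y) := by
  have : ∀ a b c d : ZMod 4, IsPrimary ⟨a, b, c, d⟩ → ∀ a' b' c' d' : ZMod 4,
      IsPrimary ⟨a', b', c', d'⟩ → IsPrimary (⟨a, b, c, d⟩ * ⟨a', b', c', d'⟩) := by
    decide +kernel
  exact this _ _ _ _ hx _ _ _ _ hy

lemma IsPrimary.of_mul {x y : HOrder (ZMod 4)} (hy : IsPrimary y) (h : IsPrimary (x * y)) :
    IsPrimary x := by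
  have : ∀ a b c d : ZMod 4, IsPrimary ⟨a, b, c, d⟩ → ∀ a' b' c' d' : ZMod 4,
      IsPrimary (⟨a', b', c', d'⟩ * ⟨a, b, c, d⟩) → IsPrimary ⟨a', b', c', d'⟩ := by
    decide +kernel
  exact this _ _ _ _ hy _ _ _ _ h

lemma IsPrimary.conj_or_neg_conj {x : HOrder (ZMod 4)} (hx : IsPrimary x) :
    IsPrimary (conj x) ∨ IsPrimary (-conj x) := by
  have : ∀ a b c d : ZMod 4, IsPrimary ⟨a, b, c, d⟩ →
      IsPrimary (conj ⟨a, b, c, d⟩) ∨ IsPrimary (-conj ⟨a, b, c, d⟩) := by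
    decide +kernel
  exact this _ _ _ _ hx

lemma IsPrimary.not_neg {x : HOrder (ZMod 4)} (hx : IsPrimary x) : ¬ IsPrimary (-x) := by
  have : ∀ a b c d : ZMod 4, IsPrimary ⟨a, b, c, d⟩ → ¬ IsPrimary (-⟨a, b, c, d⟩) := by
    decide +kernel
  exact this _ _ _ _ hx

lemma intCast_eq_iff (m n : ℤ) : (m : ZMod 4) = n ↔ (4 : ℤ) ∣ n - m :=
  ZMod.intCast_eq_intCast_iff_dvd_sub m n 4

lemma isPrimary_red_iff (x : HOrder ℤ) :
    IsPrimary (red x) ↔ (2 ∣ x.b ∧ 2 ∣ x.c ∧ 2 ∣ x.d ∧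
      ((4 ∣ x.c - x.d ∧ 4 ∣ x.a + x.b + x.c - 1) ∨
        (4 ∣ x.c - x.d - 2 ∧ 4 ∣ x.a + x.b + x.c - 3))) := by
  have hb := intCast_eq_iff (2 * x.b) 0
  have hc := intCast_eq_iff (2 * x.c) 0
  have hd := intCast_eq_iff (2 * x.d) 0
  have h1 := intCast_eq_iff x.c x.d
  have h2 := intCast_eq_iff (x.a + x.b + x.c) 1
  have h3 := intCast_eq_iff x.c (x.d + 2)
  have h4 := intCast_eq_iff (x.a + x.b + x.c) 3
  push_cast at hb hc hd h1 h2 h3 h4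
  simp only [IsPrimary, red, map, Int.coe_castRingHom, hb, hc, hd, h1, h2, h3, h4]
  omega

lemma eq_one_of_isPrimary {x : HOrder ℤ} (hx : IsPrimary (red x)) (h : norm x = 1) : x = 1 := by
  rw [isPrimary_red_iff] at hx
  obtain ⟨hb, hc, hd, hx⟩ := hx
  have h4 := four_mul_norm x
  rw [h] at h4
  have s1 := sq_nonneg (2 * x.a + x.c + x.d)
  have s2 := sq_nonneg (2 * x.b + x.c + x.d)
  have s3 := sq_nonneg x.c
  have s4 := sq_nonneg x.d
  have hc0 : x.c = 0 := by
    have h1 : x.c < 2 := by nlinarith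
    have h2 : -2 < x.c := by nlinarith
    omega
  have hd0 : x.d = 0 := by
    have h1 : x.d < 2 := by nlinarith
    have h2 : -2 < x.d := by nlinarith
    omega
  rw [hc0, hd0] at h4
  have hb0 : x.b = 0 := by
    have h1 : x.b < 2 := by nlinarith [sq_nonneg x.a]
    have h2 : -2 < x.b := by nlinarith [sq_nonneg x.a]
    omega
  rw [hb0] at h4
  have ha1 : x.a < 2 := by nlinarith
  have ha2 : -2 < x.a := by nlinarith
  ext <;> simp <;> omega

/-- The units of the order. -/
def unitList : List (HOrder ℤ) :=
  [⟨-1, -1, 0, 1⟩, ⟨-1, -1, 1, 0⟩, ⟨-1, -1, 1, 1⟩, ⟨-1, 0, 0, 0⟩, ⟨-1, 0, 0, 1⟩, ⟨-1, 0, 1, 0⟩,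
   ⟨0, -1, 0, 0⟩, ⟨0, -1, 0, 1⟩, ⟨0, -1, 1, 0⟩, ⟨0, 0, -1, 0⟩, ⟨0, 0, -1, 1⟩, ⟨0, 0, 0, -1⟩,
   ⟨0, 0, 0, 1⟩, ⟨0, 0, 1, -1⟩, ⟨0, 0, 1, 0⟩, ⟨0, 1, -1, 0⟩, ⟨0, 1, 0, -1⟩, ⟨0, 1, 0, 0⟩,
   ⟨1, 0, -1, 0⟩, ⟨1, 0, 0, -1⟩, ⟨1, 0, 0, 0⟩, ⟨1, 1, -1, -1⟩, ⟨1, 1, -1, 0⟩, ⟨1, 1, 0, -1⟩]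

lemma exists_unit_mul_isPrimary {x : HOrder ℤ} (hx : Odd (norm x)) :
    ∃ u : HOrder ℤ, norm u = 1 ∧ IsPrimary (red (u * x)) := by
  have key : ∀ a b c d : ZMod 4, 2 * norm (⟨a, b, c, d⟩ : HOrder (ZMod 4)) = 2 →
      ∃ u ∈ unitList, norm u = 1 ∧ IsPrimary (red u * ⟨a, b, c, d⟩) := by
    decide +kernel
  have h2 : 2 * norm (red x) = 2 := by
    obtain ⟨k, hk⟩ := hx
    rw [red, norm_map, hk]
    have h4 : (4 : ZMod 4) = 0 := rfl
    push_cast [Int.coe_castRingHom]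
    linear_combination (k : ZMod 4) * h4
  obtain ⟨u, -, hu, h⟩ := key _ _ _ _ h2
  exact ⟨u, hu, by rw [red_mul]; exact h⟩

lemma eq_of_unit_mul {u x y : HOrder ℤ} (hu : norm u = 1) (hx : IsPrimary (red x))
    (hy : IsPrimary (red y)) (h : x = u * y) : x = y := by
  rw [h, red_mul] at hx
  rw [h, eq_one_of_isPrimary (hy.of_mul hx) hu, one_mul]

end Primary

section Divisors

variable {p : ℕ}

lemma isPrimary_red_conj {x : HOrder ℤ} (hx : IsPrimary (red x)) :
    IsPrimary (red (conj x)) ∨ IsPrimary (red (-conj x)) := by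
  have h1 : red (conj x) = conj (red x) := by ext <;> simp [red, map, conj]
  have h2 : red (-conj x) = -conj (red x) := by ext <;> simp [red, map, conj]
  rw [h1, h2]
  exact hx.conj_or_neg_conj

lemma eq_of_eq_or_eq_neg {x y : HOrder ℤ} (hx : IsPrimary (red x)) (hy : IsPrimary (red y))
    (h : x = y ∨ x = -y) : x = y := by
  rcases h with h | h
  · exact h
  · rw [h] at hx
    have : red (-y) = -red y := by ext <;> simp [red, map]
    rw [this] at hx
    exact absurd hx hy.not_neg

/-- The primary elements of norm `n`. -/
def primarySet (n : ℕ) : Set (HOrder ℤ) := {x | IsPrimary (red x) ∧ norm x = n}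

/-- The primary elements of norm `n` not divisible by any prime. -/
def primitiveSet (n : ℕ) : Set (HOrder ℤ) :=
  {x | (IsPrimary (red x) ∧ norm x = n) ∧ ∀ q : ℕ, q.Prime → ∀ y, x ≠ const (q : ℤ) * y}

lemma dvd_of_const_mul_eq {q r : ℤ} (h : IsCoprime q r) {x y : HOrder ℤ}
    (e : const r * x = const q * y) : ∃ z, x = const q * z := by
  obtain ⟨s, t, hst⟩ := h
  refine ⟨const s * x + const t * y, ?_⟩
  simp only [const_mul, HOrder.mk.injEq] at e
  ext <;> simp only [const_mul, add_def]
  · linear_combination (-x.a) * hst + t * e.1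
  · linear_combination (-x.b) * hst + t * e.2.1
  · linear_combination (-x.c) * hst + t * e.2.2.1
  · linear_combination (-x.d) * hst + t * e.2.2.2

/-- An element of norm divisible by an odd prime `p`, but not itself divisible by `p`, has a
primary right divisor of norm `p`, which also generates the left ideal of `x` and `p`. -/
lemma exists_right_divisor (hp : p.Prime) (hp2 : p ≠ 2) {x : HOrder ℤ} (hx : (p : ℤ) ∣ norm x)
    (hx' : ∀ y, x ≠ const (p : ℤ) * y) :
    ∃ π : HOrder ℤ, IsPrimary (red π) ∧ norm π = p ∧ (∃ u, x = u * π) ∧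
      ∃ r s, π = r * x + s * const (p : ℤ) := by
  obtain ⟨g, r, s, u, v, hg, hu, hv⟩ := exists_gcd x (const (p : ℤ))
  have hpZ : Prime (p : ℤ) := Nat.prime_iff_prime_int.1 hp
  have hnp : norm v * norm g = (p : ℤ) ^ 2 := by rw [← norm_mul, ← hv, norm_const]
  have hdvd : (p : ℤ) ∣ norm g := by
    obtain ⟨k, hk⟩ := hx
    have h2 : norm g = norm (r * x) + p * ((s * conj (r * x)).a * 2 + (s * conj (r * x)).c
        + (s * conj (r * x)).d + p * norm s) := by
      rw [hg, ← const_mul_comm, const_mul]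
      simp [norm, conj]; ring
    rw [h2, norm_mul, hk]
    exact dvd_add ⟨norm r * k, by ring⟩ (dvd_mul_right _ _)
  have hgn : norm g = p := by
    have hp0 : (p : ℤ) ≠ 0 := hpZ.ne_zero
    obtain ⟨i, hi, hgi⟩ := (dvd_prime_pow hpZ 2).1 (Dvd.intro_left _ hnp)
    replace hgi := Int.eq_of_associated_of_nonneg hgi (norm_nonneg g) (by positivity)
    interval_cases i
    · rw [hgi, pow_zero] at hdvd
      exact absurd (isUnit_of_dvd_one hdvd) hpZ.not_isUnit
    · simpa using hgi
    · exfalso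
      have hv1 : norm v = 1 := by
        rw [hgi] at hnp
        exact mul_right_cancel₀ (pow_ne_zero 2 hp0) (by rw [hnp, one_mul])
      apply hx' (u * conj v)
      have hone : (const 1 : HOrder ℤ) = 1 := rfl
      rw [const_mul_comm, mul_assoc, hv, ← mul_assoc (conj v), conj_mul, hv1, hone, one_mul, hu]
  obtain ⟨w, hw, hwg⟩ := exists_unit_mul_isPrimary (x := g) (by
    rw [hgn]; exact_mod_cast hp.odd_of_ne_two hp2)
  refine ⟨w * g, hwg, by rw [norm_mul, hw, one_mul, hgn], ⟨u * conj w, ?_⟩, w * r, w * s, ?_⟩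
  · rw [mul_assoc, ← mul_assoc (conj w), conj_mul, hw, hu]
    exact congrArg _ (one_mul g).symm
  · rw [hg]; noncomm_ring

lemma right_divisor_unique (hp : p.Prime) (hp2 : p ≠ 2) {x : HOrder ℤ} (hx : (p : ℤ) ∣ norm x)
    (hx' : ∀ y, x ≠ const (p : ℤ) * y) {π ρ : HOrder ℤ} (hπ : π ∈ primarySet p)
    (hρ : ρ ∈ primarySet p) (hxπ : ∃ u, x = u * π) (hxρ : ∃ u, x = u * ρ) : π = ρ := by
  obtain ⟨g, hg, hgn, -, r, s, hrs⟩ := exists_right_divisor hp hp2 hx hx'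
  have key : ∀ {σ : HOrder ℤ}, σ ∈ primarySet p → (∃ u, x = u * σ) → g = σ := by
    rintro σ ⟨hσ, hσn⟩ ⟨u, hu⟩
    have h : g = (r * u + s * conj σ) * σ := by
      rw [add_mul, mul_assoc, mul_assoc, conj_mul, ← hu, hσn]; exact hrs
    refine eq_of_unit_mul ?_ hg hσ h
    have := congrArg norm h
    rw [norm_mul, hgn, hσn] at this
    exact (mul_right_cancel₀ (Nat.cast_ne_zero.2 hp.ne_zero) (by rw [← this, one_mul]))
  exact (key hπ hxπ).symm.trans (key hρ hxρ)

lemma ne_const_mul_of_norm_eq (hp : p.Prime) {x : HOrder ℤ} (hx : norm x = p) {q : ℕ}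
    (hq : q.Prime) (y : HOrder ℤ) : x ≠ const (q : ℤ) * y := by
  intro h
  have h1 : (q : ℤ) ^ 2 * norm y = p := by rw [← hx, h, norm_mul, norm_const]
  have h2 : q ^ 2 ∣ p := by exact_mod_cast (Dvd.intro _ h1 : ((q : ℤ) ^ 2 ∣ p))
  have h3 := (Nat.prime_dvd_prime_iff_eq hq hp).1 ((dvd_pow_self q two_ne_zero).trans h2)
  subst h3
  have := Nat.le_of_dvd hp.pos h2
  nlinarith [hp.two_le]

lemma mul_mem_primitiveSet (hp : p.Prime) {n : ℕ} {d π : HOrder ℤ} (hd : d ∈ primitiveSet n)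
    (hπ : π ∈ primarySet p) (h : ¬ ∃ u, d = u * conj π) : d * π ∈ primitiveSet (p * n) := by
  refine ⟨⟨?_, ?_⟩, fun q hq y hy => ?_⟩
  · rw [red_mul]; exact hd.1.1.mul hπ.1
  · rw [norm_mul, hd.1.2, hπ.2]; push_cast; ring
  · by_cases hqp : q = p
    · subst hqp
      refine h ⟨y, mul_right_cancel_of_norm (z := π) ?_ ?_⟩
      · rw [hπ.2]; exact_mod_cast hp.ne_zero
      · rw [hy, mul_assoc, conj_mul, hπ.2, const_mul_comm]
    · have h1 : const (p : ℤ) * d = const (q : ℤ) * (y * conj π) := by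
        rw [← mul_assoc, ← hy, mul_assoc, mul_conj, hπ.2, const_mul_comm]
      obtain ⟨z, hz⟩ := dvd_of_const_mul_eq
        (Nat.isCoprime_iff_coprime.2 ((Nat.coprime_primes hq hp).2 hqp)) h1
      exact hd.2 q hq z hz

lemma bijOn_mul (hp : p.Prime) (hp2 : p ≠ 2) (n : ℕ) :
    Set.BijOn (fun z : HOrder ℤ × HOrder ℤ => z.1 * z.2)
      ((primitiveSet n ×ˢ primarySet p) \ {z | ∃ u, z.1 = u * conj z.2})
      (primitiveSet (p * n)) := by
  have hp0 : (p : ℤ) ≠ 0 := by exact_mod_cast hp.ne_zero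
  have hdvd : ∀ x ∈ primitiveSet (p * n), (p : ℤ) ∣ norm x := fun x hx => by
    rw [hx.1.2]; exact ⟨n, by push_cast; ring⟩
  refine ⟨fun z hz => mul_mem_primitiveSet hp hz.1.1 hz.1.2 hz.2, ?_, ?_⟩
  · rintro ⟨d, π⟩ ⟨⟨hd, hπ⟩, h⟩ ⟨e, ρ⟩ ⟨⟨he, hρ⟩, -⟩ heq
    simp only at heq hd hπ he hρ h
    have hmem := mul_mem_primitiveSet hp hd hπ h
    have hπρ : π = ρ := right_divisor_unique hp hp2 (hdvd _ hmem) (hmem.2 p hp) hπ hρ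
      ⟨d, rfl⟩ ⟨e, heq⟩
    subst hπρ
    rw [mul_right_cancel_of_norm (by rw [hπ.2]; exact hp0) heq]
  · intro x hx
    obtain ⟨π, hπ, hπn, ⟨d, rfl⟩, -⟩ := exists_right_divisor hp hp2 (hdvd x hx) (hx.2 p hp)
    have hdn : norm d = n := by
      have := hx.1.2
      rw [norm_mul, hπn] at this
      push_cast at this
      exact mul_right_cancel₀ hp0 (by rw [this]; ring)
    refine ⟨(d, π), ⟨⟨⟨⟨?_, hdn⟩, fun q hq y hy => ?_⟩, hπ, hπn⟩, ?_⟩, rfl⟩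
    · exact hπ.of_mul (by rw [← red_mul]; exact hx.1.1)
    · exact hx.2 q hq (y * π) (by rw [← mul_assoc, ← hy])
    · rintro ⟨u, hu⟩
      simp only at hu
      exact hx.2 p hp u (by rw [hu, mul_assoc, conj_mul, hπn, const_mul_comm])

lemma bijOn_fst (hp : p.Prime) (hp2 : p ≠ 2) {n : ℕ} (hn : p ∣ n) :
    Set.BijOn Prod.fst
      ((primitiveSet n ×ˢ primarySet p) ∩ {z | ∃ u, z.1 = u * conj z.2}) (primitiveSet n) := by
  have hdvd : ∀ x ∈ primitiveSet n, (p : ℤ) ∣ norm x := fun x hx => by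
    rw [hx.1.2]; exact_mod_cast hn
  have hconj : ∀ π ∈ primarySet p, ∃ ρ ∈ primarySet p, ρ = conj π ∨ ρ = -conj π := by
    rintro π ⟨hπ, hπn⟩
    rcases isPrimary_red_conj hπ with h | h
    · exact ⟨_, ⟨h, by rw [norm_conj, hπn]⟩, Or.inl rfl⟩
    · exact ⟨_, ⟨h, by rw [norm_neg, norm_conj, hπn]⟩, Or.inr rfl⟩
  have hright : ∀ {d π ρ : HOrder ℤ}, (ρ = conj π ∨ ρ = -conj π) →
      (∃ u, d = u * conj π) → ∃ u, d = u * ρ := by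
    rintro d π ρ (rfl | rfl) ⟨u, hu⟩
    · exact ⟨u, hu⟩
    · exact ⟨-u, by rw [hu]; noncomm_ring⟩
  refine ⟨fun z hz => hz.1.1, ?_, ?_⟩
  · rintro ⟨d, π⟩ ⟨⟨hd, hπ⟩, h⟩ ⟨e, ρ⟩ ⟨⟨he, hρ⟩, h'⟩ heq
    simp only at heq hd hπ he hρ h h'
    subst heq
    obtain ⟨π', hπ', hππ'⟩ := hconj π hπ
    obtain ⟨ρ', hρ', hρρ'⟩ := hconj ρ hρ
    have key : π' = ρ' := right_divisor_unique hp hp2 (hdvd _ hd) (hd.2 p hp) hπ' hρ'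
      (hright hππ' h) (hright hρρ' h')
    have : π = ρ := by
      refine eq_of_eq_or_eq_neg hπ.1 hρ.1 ?_
      rw [← conj_conj π, ← conj_conj ρ, ← conj_neg]
      rcases hππ' with h1 | h1 <;> rcases hρρ' with h2 | h2 <;> rw [key, h2] at h1
      · exact Or.inl (by rw [h1])
      · exact Or.inr (by rw [← h1])
      · exact Or.inr (by rw [h1, neg_neg])
      · exact Or.inl (by rw [neg_injective h1])
    rw [this]
  · intro d hd
    obtain ⟨π, hπ, hπn, hu, -⟩ := exists_right_divisor hp hp2 (hdvd d hd) (hd.2 p hp)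
    obtain ⟨ρ, hρ, hρπ⟩ := hconj π ⟨hπ, hπn⟩
    refine ⟨(d, ρ), ⟨⟨hd, hρ⟩, ?_⟩, rfl⟩
    rcases hρπ with rfl | rfl
    · simpa using hu
    · obtain ⟨u, hu⟩ := hu
      refine ⟨-u, ?_⟩
      simp only [conj_neg, conj_conj]
      rw [hu]; noncomm_ring

lemma primitiveSet_mul (hp : p.Prime) (hp2 : p ≠ 2) {n : ℕ} (hfin : (primitiveSet n).Finite)
    (hpfin : (primarySet p).Finite) (hpcard : (primarySet p).ncard = p + 1) :
    (primitiveSet (p * n)).Finite ∧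
      (primitiveSet (p * n)).ncard =
        (if p ∣ n then p else p + 1) * (primitiveSet n).ncard := by
  have hprod := hfin.prod hpfin
  have hb := bijOn_mul hp hp2 n
  have hcard := hb.ncard_eq
  refine ⟨by rw [← hb.image_eq]; exact (hprod.subset Set.sdiff_subset).image _, ?_⟩
  have hsum := Set.ncard_inter_add_ncard_sdiff_eq_ncard (primitiveSet n ×ˢ primarySet p)
    {z | ∃ u, z.1 = u * conj z.2} hprod
  rw [Set.ncard_prod, hpcard, hcard] at hsum
  split_ifs with hn
  · rw [(bijOn_fst hp hp2 hn).ncard_eq] at hsum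
    linarith
  · have hempty : (primitiveSet n ×ˢ primarySet p) ∩ {z | ∃ u, z.1 = u * conj z.2} = ∅ := by
      rw [Set.eq_empty_iff_forall_notMem]
      rintro ⟨d, π⟩ ⟨⟨hd, hπ⟩, u, hu⟩
      simp only at hd hπ hu
      apply hn
      have : norm u * p = n := by rw [← hd.1.2, hu, norm_mul, norm_conj, hπ.2]
      exact_mod_cast (Dvd.intro_left _ this : (p : ℤ) ∣ n)
    rw [hempty, Set.ncard_empty] at hsum
    linarith

end Divisors

section Matrices

variable {F : Type*} [Field F]

/-- The representation by `2 × 2` matrices attached to a solution of `x ^ 2 + y ^ 2 = -2`. -/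
def rep (x y : F) (z : HOrder F) : Matrix (Fin 2) (Fin 2) F :=
  !![z.a + (z.c + z.d) / 2 + (x * z.c - y * z.d) / 2,
      -(z.b + (z.c + z.d) / 2) + (y * z.c + x * z.d) / 2;
     z.b + (z.c + z.d) / 2 + (y * z.c + x * z.d) / 2,
      z.a + (z.c + z.d) / 2 - (x * z.c - y * z.d) / 2]

variable {x y : F} (h2 : (2 : F) ≠ 0) (h : x ^ 2 + y ^ 2 = -2)

include h2 h

lemma rep_mul (z w : HOrder F) : rep x y (z * w) = rep x y z * rep x y w := by
  ext i j
  fin_cases i <;> fin_cases j <;> simp [rep, Matrix.mul_apply, Fin.sum_univ_two] <;> grind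

lemma det_rep (z : HOrder F) : (rep x y z).det = norm z := by
  simp only [rep, Matrix.det_fin_two_of, norm]
  grind

lemma rep_surjective : Function.Surjective (rep x y) := by
  intro M
  let c := -(x * (M 0 0 - M 1 1) + y * (M 0 1 + M 1 0)) / 2
  let d := -(-y * (M 0 0 - M 1 1) + x * (M 0 1 + M 1 0)) / 2
  refine ⟨⟨(M 0 0 + M 1 1) / 2 - (c + d) / 2, (M 1 0 - M 0 1) / 2 - (c + d) / 2, c, d⟩, ?_⟩
  ext i j
  fin_cases i <;> fin_cases j <;> simp [rep, c, d] <;> grind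

lemma rep_injective : Function.Injective (rep x y) := by
  intro z w hzw
  have h00 := congrFun (congrFun hzw 0) 0
  have h01 := congrFun (congrFun hzw 0) 1
  have h10 := congrFun (congrFun hzw 1) 0
  have h11 := congrFun (congrFun hzw 1) 1
  simp only [rep, Matrix.of_apply, Matrix.cons_val', Matrix.cons_val_zero, Matrix.cons_val_one,
    Matrix.cons_val_fin_one] at h00 h01 h10 h11
  have hc : z.c = w.c := by grind
  have hd : z.d = w.d := by grind
  ext
  · grind
  · grind
  · exact hc
  · exact hd

omit h2 h

/-- Representatives of the points of the projective line over `F`, as second rows of matrices. -/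
def lineMatrix : Option F → Matrix (Fin 2) (Fin 2) F
  | none => !![0, 0; 0, 1]
  | some t => !![0, 0; 1, t]

lemma det_lineMatrix (t : Option F) : (lineMatrix t).det = 0 := by
  cases t <;> simp [lineMatrix]

lemma lineMatrix_ne_zero (t : Option F) : lineMatrix t ≠ 0 := by
  intro h
  have h0 := congrFun (congrFun h 1) 0
  have h1 := congrFun (congrFun h 1) 1
  cases t <;> simp [lineMatrix] at h0 h1

lemma exists_lineMatrix_eq_mul {M : Matrix (Fin 2) (Fin 2) F} (hM : M ≠ 0) :
    ∃ t A, lineMatrix t = A * M := by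
  have key : ∀ i, (M i 0 ≠ 0 ∨ M i 1 ≠ 0) → ∃ t A, lineMatrix t = A * M := by
    intro i hi
    by_cases h0 : M i 0 = 0
    · have h1 : M i 1 ≠ 0 := by simpa [h0] using hi
      refine ⟨none, Matrix.of ![0, Pi.single i (M i 1)⁻¹], ?_⟩
      ext k l
      fin_cases k <;> fin_cases l <;> simp [lineMatrix, Matrix.mul_apply, Pi.single_apply, h0, h1]
    · refine ⟨some (M i 1 / M i 0), Matrix.of ![0, Pi.single i (M i 0)⁻¹], ?_⟩
      ext k l
      fin_cases k <;> fin_cases l <;>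
        simp [lineMatrix, Matrix.mul_apply, Pi.single_apply, h0, div_eq_inv_mul]
  by_contra hcon
  apply hM
  ext i j
  by_contra hij
  apply hcon
  fin_cases j
  · exact key i (Or.inl hij)
  · exact key i (Or.inr hij)

lemma eq_of_lineMatrix_eq_mul {M A B : Matrix (Fin 2) (Fin 2) F} (hM : M.det = 0)
    {s t : Option F} (hs : lineMatrix s = A * M) (ht : lineMatrix t = B * M) : s = t := by
  have hs0 := congrFun (congrFun hs 1) 0
  have hs1 := congrFun (congrFun hs 1) 1
  have ht0 := congrFun (congrFun ht 1) 0
  have ht1 := congrFun (congrFun ht 1) 1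
  rw [Matrix.det_fin_two] at hM
  have key : lineMatrix s 1 0 * lineMatrix t 1 1 - lineMatrix s 1 1 * lineMatrix t 1 0 = 0 := by
    rw [hs0, hs1, ht0, ht1]
    simp only [Matrix.mul_apply, Fin.sum_univ_two]
    linear_combination (A 1 0 * B 1 1 - A 1 1 * B 1 0) * hM
  cases s <;> cases t <;> simp [lineMatrix] at key ⊢
  linear_combination -key

end Matrices

section PrimeCount

variable {p : ℕ} [Fact p.Prime]

/-- Reduction modulo `p` followed by the matrix representation. -/
def repMod (x y : ZMod p) (z : HOrder ℤ) : Matrix (Fin 2) (Fin 2) (ZMod p) :=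
  rep x y (map (Int.castRingHom (ZMod p)) z)

variable {x y : ZMod p} (h2 : (2 : ZMod p) ≠ 0) (h : x ^ 2 + y ^ 2 = -2)

include h2 h

lemma repMod_mul (z w : HOrder ℤ) : repMod x y (z * w) = repMod x y z * repMod x y w := by
  rw [repMod, map_mul, rep_mul h2 h]; rfl

lemma det_repMod (z : HOrder ℤ) : (repMod x y z).det = ((norm z : ℤ) : ZMod p) := by
  rw [repMod, det_rep h2 h, norm_map]; rfl

lemma repMod_surjective : Function.Surjective (repMod x y) := by
  intro M
  obtain ⟨z, rfl⟩ := rep_surjective h2 h M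
  obtain ⟨a, ha⟩ := ZMod.intCast_surjective z.a
  obtain ⟨b, hb⟩ := ZMod.intCast_surjective z.b
  obtain ⟨c, hc⟩ := ZMod.intCast_surjective z.c
  obtain ⟨d, hd⟩ := ZMod.intCast_surjective z.d
  exact ⟨⟨a, b, c, d⟩, by simp [repMod, map, ha, hb, hc, hd]⟩

lemma eq_add_of_repMod_eq {z w : HOrder ℤ} (hzw : repMod x y z = repMod x y w) :
    ∃ v, z = w + v * const (p : ℤ) := by
  have hinj := rep_injective h2 h hzw
  simp only [map, HOrder.mk.injEq, eq_intCast] at hinj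
  obtain ⟨ha, hb, hc, hd⟩ := hinj
  rw [eq_comm, ZMod.intCast_eq_intCast_iff_dvd_sub] at ha hb hc hd
  obtain ⟨a, ha⟩ := ha
  obtain ⟨b, hb⟩ := hb
  obtain ⟨c, hc⟩ := hc
  obtain ⟨d, hd⟩ := hd
  refine ⟨⟨a, b, c, d⟩, ?_⟩
  rw [← const_mul_comm, const_mul]
  ext <;> simp only [add_def] <;> linarith

omit h2 h in
lemma repMod_const_mul (z : HOrder ℤ) : repMod x y (const (p : ℤ) * z) = 0 := by
  rw [const_mul]
  ext i j
  fin_cases i <;> fin_cases j <;> simp [repMod, map, rep]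

lemma card_primarySet_of_sq_add_sq (hp2 : p ≠ 2) : Nat.card (primarySet p) = p + 1 := by
  have hp : p.Prime := Fact.out
  have hdet : ∀ z : HOrder ℤ, (repMod x y z).det = 0 ↔ (p : ℤ) ∣ norm z := fun z => by
    rw [det_repMod h2 h, ZMod.intCast_zmod_eq_zero_iff_dvd]
  choose X hX using fun t : Option (ZMod p) => repMod_surjective h2 h (lineMatrix t)
  have hXn : ∀ t, (p : ℤ) ∣ norm (X t) := fun t => by
    rw [← hdet, hX, det_lineMatrix]
  have hX' : ∀ t z, X t ≠ const (p : ℤ) * z := fun t z hz => by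
    apply lineMatrix_ne_zero t
    rw [← hX, hz, repMod_const_mul]
  choose g hg1 hg2 hgX _ using fun t => exists_right_divisor hp hp2 (hXn t) (hX' t)
  choose u hu using hgX
  have hbij : Function.Bijective (fun t => (⟨g t, hg1 t, hg2 t⟩ : primarySet p)) := by
    constructor
    · intro s t hst
      have hst' : g s = g t := congrArg Subtype.val hst
      refine eq_of_lineMatrix_eq_mul (M := repMod x y (g t)) (A := repMod x y (u s))
        (B := repMod x y (u t)) ?_ ?_ ?_
      · rw [hdet, hg2]
      · rw [← hX, ← repMod_mul h2 h, ← hst', ← hu]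
      · rw [← hX, ← repMod_mul h2 h, ← hu]
    · rintro ⟨π, hπ⟩
      have hM : repMod x y π ≠ 0 := by
        rw [← repMod_const_mul 0]
        intro hz
        obtain ⟨v, hv⟩ := eq_add_of_repMod_eq h2 h hz
        rw [mul_zero, zero_add, ← const_mul_comm] at hv
        exact ne_const_mul_of_norm_eq hp hπ.2 hp v hv
      obtain ⟨t, A, ht⟩ := exists_lineMatrix_eq_mul hM
      obtain ⟨w, rfl⟩ := repMod_surjective h2 h A
      rw [← hX, ← repMod_mul h2 h] at ht
      obtain ⟨v, hv⟩ := eq_add_of_repMod_eq h2 h ht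
      refine ⟨t, Subtype.ext ?_⟩
      refine right_divisor_unique hp hp2 (hXn t) (hX' t) ⟨hg1 t, hg2 t⟩ hπ ⟨u t, hu t⟩
        ⟨w + v * conj π, ?_⟩
      rw [add_mul, mul_assoc, conj_mul, hπ.2, hv]
  rw [← Nat.card_congr (Equiv.ofBijective _ hbij), Finite.card_option, Nat.card_zmod]

omit h2 h

lemma card_primarySet (hp2 : p ≠ 2) : (primarySet p).ncard = p + 1 := by
  have h2 : (2 : ZMod p) ≠ 0 := by
    intro h0
    have : p ∣ 2 := (ZMod.natCast_eq_zero_iff 2 p).1 (by exact_mod_cast h0)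
    exact hp2 ((Nat.prime_dvd_prime_iff_eq Fact.out Nat.prime_two).1 this)
  obtain ⟨x, y, h⟩ := ZMod.sq_add_sq p (-2)
  exact card_primarySet_of_sq_add_sq h2 h hp2

end PrimeCount

lemma primitiveSet_one : primitiveSet 1 = {1} := by
  ext x
  simp only [Set.mem_singleton_iff]
  constructor
  · intro hx
    exact eq_one_of_isPrimary hx.1.1 (by exact_mod_cast hx.1.2)
  · rintro rfl
    refine ⟨⟨by decide, by simp [norm]⟩, fun q hq y hy => ?_⟩
    have ha := congrArg HOrder.a hy
    rw [const_mul, one_def] at ha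
    have hdvd : q ∣ 1 := by exact_mod_cast (Dvd.intro _ ha.symm : (q : ℤ) ∣ 1)
    exact hq.one_lt.ne' (Nat.dvd_one.1 hdvd)

lemma finite_and_ncard_primitiveSet (m : ℕ) (hm : Odd m) :
    (primitiveSet m).Finite ∧
      ((primitiveSet m).ncard : ℚ) = m * ∏ p ∈ m.primeFactors, (1 + 1 / (p : ℚ)) := by
  induction m using induction_on_primes with
  | zero => simp at hm
  | one => simp [primitiveSet_one]
  | prime_mul p n hp ih =>
    have : Fact p.Prime := ⟨hp⟩
    obtain ⟨hpo, hno⟩ := Nat.odd_mul.1 hm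
    have hp2 : p ≠ 2 := by rintro rfl; exact absurd hpo (by decide)
    have hn0 : n ≠ 0 := by rintro rfl; exact absurd hno (by decide)
    have hp0 : (p : ℚ) ≠ 0 := by exact_mod_cast hp.ne_zero
    obtain ⟨hfin, hcard⟩ := ih hno
    have hP := card_primarySet (p := p) hp2
    obtain ⟨hfin', hcard'⟩ := primitiveSet_mul hp hp2 hfin
      (Set.finite_of_ncard_ne_zero (by rw [hP]; omega)) hP
    refine ⟨hfin', ?_⟩
    rw [hcard', Nat.primeFactors_mul hp.ne_zero hn0, hp.primeFactors]
    by_cases hpn : p ∣ n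
    · have hmem : p ∈ n.primeFactors := Nat.mem_primeFactors.2 ⟨hp, hpn, hn0⟩
      rw [if_pos hpn, Finset.union_eq_right.2 (Finset.singleton_subset_iff.2 hmem)]
      push_cast
      rw [hcard]; ring
    · have hmem : p ∉ n.primeFactors := fun hmem => hpn (Nat.dvd_of_mem_primeFactors hmem)
      rw [if_neg hpn, ← Finset.insert_eq, Finset.prod_insert hmem]
      push_cast
      rw [hcard]; field_simp

section Quaternions

/-- The quaternion with given coordinates with respect to `v₁, v₂, v₃, v₄`. -/
def toQuaternion (x : HOrder ℤ) : ℍ[ℝ] := x.a • v₁ + x.b • v₂ + x.c • v₃ + x.d • v₄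

@[simp] lemma v₁_components : v₁.re = 1 ∧ v₁.imI = 0 ∧ v₁.imJ = 0 ∧ v₁.imK = 0 :=
  ⟨rfl, rfl, rfl, rfl⟩

@[simp] lemma v₂_components : v₂.re = 0 ∧ v₂.imI = 1 ∧ v₂.imJ = 0 ∧ v₂.imK = 0 :=
  ⟨rfl, rfl, rfl, rfl⟩

@[simp] lemma v₃_components : v₃.re = 1 / 2 ∧ v₃.imI = 1 / 2 ∧ v₃.imJ = √2 / 2 ∧ v₃.imK = 0 :=
  ⟨rfl, rfl, rfl, rfl⟩

@[simp] lemma v₄_components : v₄.re = 1 / 2 ∧ v₄.imI = 1 / 2 ∧ v₄.imJ = 0 ∧ v₄.imK = √2 / 2 :=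
  ⟨rfl, rfl, rfl, rfl⟩

lemma toQuaternion_components (x : HOrder ℤ) :
    (toQuaternion x).re = x.a + (x.c + x.d) / 2 ∧ (toQuaternion x).imI = x.b + (x.c + x.d) / 2 ∧
      (toQuaternion x).imJ = √2 / 2 * x.c ∧ (toQuaternion x).imK = √2 / 2 * x.d := by
  refine ⟨?_, ?_, ?_, ?_⟩ <;> simp [toQuaternion] <;> ring

lemma toQuaternion_injective : Function.Injective toQuaternion := by
  intro x y h
  obtain ⟨ha, hb, hc, hd⟩ := toQuaternion_components x
  obtain ⟨ha', hb', hc', hd'⟩ := toQuaternion_components y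
  rw [h] at ha hb hc hd
  have h2 : √2 / 2 ≠ (0 : ℝ) := by positivity
  replace hc := mul_left_cancel₀ h2 (hc.symm.trans hc')
  replace hd := mul_left_cancel₀ h2 (hd.symm.trans hd')
  replace ha := ha.symm.trans ha'
  replace hb := hb.symm.trans hb'
  rw [hc, hd] at ha hb
  ext
  · exact_mod_cast add_right_cancel ha
  · exact_mod_cast add_right_cancel hb
  · exact_mod_cast hc
  · exact_mod_cast hd

lemma toQuaternion_mul (x y : HOrder ℤ) :
    toQuaternion (x * y) = toQuaternion x * toQuaternion y := by
  have h : √2 ^ 2 = (2 : ℝ) := Real.sq_sqrt (by norm_num)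
  ext <;> simp [toQuaternion_components]
  · linear_combination (x.c * y.c + x.d * y.d : ℝ) / 4 * h
  · linear_combination (x.d * y.c - x.c * y.d : ℝ) / 4 * h
  · ring
  · ring

lemma toQuaternion_sub (x y : HOrder ℤ) :
    toQuaternion (x - y) = toQuaternion x - toQuaternion y := by
  ext <;> simp [toQuaternion_components] <;> ring

lemma toQuaternion_mul_star (x : HOrder ℤ) :
    toQuaternion x * star (toQuaternion x) = (((norm x : ℤ) : ℝ) : ℍ[ℝ]) := by
  have h : √2 ^ 2 = (2 : ℝ) := Real.sq_sqrt (by norm_num)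
  ext <;> simp [toQuaternion_components]
  · simp only [norm]
    push_cast
    linear_combination (x.c ^ 2 + x.d ^ 2 : ℝ) / 4 * h
  · ring
  · ring
  · ring

lemma mem_H122_iff (q : ℍ[ℝ]) : q ∈ H122 ↔ ∃ x, toQuaternion x = q :=
  ⟨fun ⟨a, b, c, d, h⟩ => ⟨⟨a, b, c, d⟩, h.symm⟩, fun ⟨x, h⟩ => ⟨x.a, x.b, x.c, x.d, h.symm⟩⟩

lemma exists_sub_eq_iff (x y : HOrder ℤ) :
    (∃ h ∈ H122, toQuaternion x - toQuaternion y = 2 * (1 + v₂) * h) ↔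
      ∃ h, x - y = ⟨2, 2, 0, 0⟩ * h := by
  have h2 : toQuaternion ⟨2, 2, 0, 0⟩ = 2 * (1 + v₂) := by
    rw [two_mul]
    ext <;> simp [toQuaternion_components] <;> norm_num
  rw [← h2, ← toQuaternion_sub]
  constructor
  · rintro ⟨h, hh, he⟩
    obtain ⟨z, rfl⟩ := (mem_H122_iff h).1 hh
    exact ⟨z, toQuaternion_injective (by rw [he, toQuaternion_mul])⟩
  · rintro ⟨z, hz⟩
    exact ⟨_, (mem_H122_iff _).2 ⟨z, rfl⟩, by rw [hz, toQuaternion_mul]⟩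

lemma exists_eq_mul_iff (x : HOrder ℤ) :
    (∃ h, x = ⟨2, 2, 0, 0⟩ * h) ↔
      2 ∣ x.a ∧ 2 ∣ x.b ∧ 2 ∣ x.c ∧ 2 ∣ x.d ∧ 4 ∣ x.c - x.d ∧ 4 ∣ x.a + x.b + x.c := by
  constructor
  · rintro ⟨h, rfl⟩
    simp only [mul_def]
    omega
  · rintro ⟨⟨a, ha⟩, ⟨b, hb⟩, ⟨c, hc⟩, ⟨d, hd⟩, ⟨e, he⟩, ⟨f, hf⟩⟩
    refine ⟨⟨f, b - f + e, c - e, -e⟩, ?_⟩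
    ext <;> simp only [mul_def] <;> linarith

lemma primary_toQuaternion_iff (x : HOrder ℤ) :
    Primary (toQuaternion x) ↔ IsPrimary (red x) := by
  have h1 : (1 : ℍ[ℝ]) = toQuaternion ⟨1, 0, 0, 0⟩ := by
    ext <;> simp [toQuaternion_components]
  have h3 : 1 + 2 * v₃ = toQuaternion ⟨1, 0, 2, 0⟩ := by
    rw [two_mul]
    ext <;> simp [toQuaternion_components] <;> ring
  have hmem : toQuaternion x ∈ H122 := (mem_H122_iff _).2 ⟨x, rfl⟩
  have e1 := exists_sub_eq_iff x ⟨1, 0, 0, 0⟩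
  have e3 := exists_sub_eq_iff x ⟨1, 0, 2, 0⟩
  rw [← h1, exists_eq_mul_iff] at e1
  rw [← h3, exists_eq_mul_iff] at e3
  rw [Primary, e1, e3, isPrimary_red_iff]
  simp only [hmem, true_and, sub_def]
  omega

lemma primitive_toQuaternion_iff (x : HOrder ℤ) {m : ℕ} :
    (Primitive (toQuaternion x) ∧ toQuaternion x * star (toQuaternion x) = (m : ℍ[ℝ])) ↔
      x ∈ primitiveSet m := by
  have hgcd : (∀ c₁ c₂ c₃ c₄ : ℤ, toQuaternion x = c₁ • v₁ + c₂ • v₂ + c₃ • v₃ + c₄ • v₄ →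
      Int.gcd (Int.gcd c₁ c₂) (Int.gcd c₃ c₄) = 1) ↔
      ∀ q : ℕ, q.Prime → ∀ y, x ≠ const (q : ℤ) * y := by
    constructor
    · intro h q hq y hy
      have h1 := h x.a x.b x.c x.d rfl
      have hdvd : (q : ℤ) ∣ Int.gcd (Int.gcd x.a x.b) (Int.gcd x.c x.d) := by
        rw [hy, const_mul]
        exact Int.dvd_coe_gcd (Int.dvd_coe_gcd (dvd_mul_right _ _) (dvd_mul_right _ _))
          (Int.dvd_coe_gcd (dvd_mul_right _ _) (dvd_mul_right _ _))
      rw [h1] at hdvd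
      exact hq.one_lt.ne' (Nat.dvd_one.1 (by exact_mod_cast hdvd))
    · intro h c₁ c₂ c₃ c₄ hc
      obtain rfl : x = ⟨c₁, c₂, c₃, c₄⟩ := toQuaternion_injective hc
      by_contra hne
      obtain ⟨q, hq, hdvd⟩ := Nat.exists_prime_and_dvd hne
      have hdvd' := Int.natCast_dvd_natCast.2 hdvd
      have h12 := hdvd'.trans (Int.gcd_dvd_left _ _)
      have h34 := hdvd'.trans (Int.gcd_dvd_right _ _)
      obtain ⟨y₁, h₁⟩ := h12.trans (Int.gcd_dvd_left _ _)
      obtain ⟨y₂, h₂⟩ := h12.trans (Int.gcd_dvd_right _ _)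
      obtain ⟨y₃, h₃⟩ := h34.trans (Int.gcd_dvd_left _ _)
      obtain ⟨y₄, h₄⟩ := h34.trans (Int.gcd_dvd_right _ _)
      exact h q hq ⟨y₁, y₂, y₃, y₄⟩ (by rw [const_mul, ← h₁, ← h₂, ← h₃, ← h₄])
  have hnorm : toQuaternion x * star (toQuaternion x) = (m : ℍ[ℝ]) ↔ norm x = m := by
    rw [toQuaternion_mul_star]
    have hm : (m : ℍ[ℝ]) = ((m : ℝ) : ℍ[ℝ]) := rfl
    rw [hm, Quaternion.coe_inj]
    exact_mod_cast Iff.rfl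
  rw [Primitive, hgcd, primary_toQuaternion_iff, hnorm, primitiveSet, Set.mem_ofPred_eq]
  tauto

lemma setOf_primitive_eq_image (m : ℕ) :
    {c : ℍ[ℝ] | Primitive c ∧ c * star c = (m : ℍ[ℝ])} = toQuaternion '' primitiveSet m := by
  ext c
  constructor
  · rintro hc
    obtain ⟨x, rfl⟩ := (mem_H122_iff c).1 hc.1.1.1
    exact ⟨x, (primitive_toQuaternion_iff x).1 hc, rfl⟩
  · rintro ⟨x, hx, rfl⟩
    exact (primitive_toQuaternion_iff x).2 hx

end Quaternions

end HOrder

/-- For `m` odd and positive, the set of primitive quaternions of norm `m` in `H₍₁,₂,₂₎`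
is finite of cardinality `m · ∏_{p ∣ m} (1 + 1/p)`. -/
theorem primitive_count (m : ℕ) (hm : Odd m) (hpos : 0 < m) :
    {c : ℍ[ℝ] | Primitive c ∧ c * star c = (m : ℍ[ℝ])}.Finite ∧
    ({c : ℍ[ℝ] | Primitive c ∧ c * star c = (m : ℍ[ℝ])}.ncard : ℚ) =
      m * ∏ p ∈ m.primeFactors, (1 + 1 / (p : ℚ)) := by
  rw [HOrder.setOf_primitive_eq_image,
    Set.ncard_image_of_injective _ HOrder.toQuaternion_injective]
  obtain ⟨hfin, hcard⟩ := HOrder.finite_and_ncard_primitiveSet m hm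
  exact ⟨hfin.image _, hcard⟩
end
end
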